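/- arXiv:2205.12703 — 3 statements merged into one kernel-verified Lean document; each statement's English description precedes it below -/
import Mathlib

section
/- Let C be a prevariety of languages over a finite alphabet A and let α : A* → M be a surjective monoid morphism into a finite monoid. The following are equivalent: (1) α is a UPol(C)-morphism (i.e., α⁻¹(F) ∈ UPol(C) for every F ⊆ M); (2) α is an APol(C)-morphism; (3) α is a WAPol(C)-morphism; (4) s^{ω+1} = s^ω t s^ω for every C-pair (s,t) ∈ M × M for α; (5) s^{ω+1} = s^ω t s^ω for all s, t ∈ M with s ∼_C t. -/
/- Common definitions: languages over a finite alphabet, classes of languages,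
prevarieties, polynomial closure and its variants, separation, C-pairs, etc. -/

namespace RegLang

variable {A : Type}

/-- A language over the alphabet `A`: a set of finite words. -/
abbrev Lang (A : Type) := Set (FreeMonoid A)

/-- A class of languages over the alphabet `A`. -/
abbrev LangClass (A : Type) := Set (Lang A)

/-- A lattice of languages: contains `∅` and `A*` and is closed under binary
union and intersection. -/
def IsLatticeClass (C : LangClass A) : Prop :=
  ∅ ∈ C ∧ (Set.univ : Lang A) ∈ C ∧
    (∀ K L : Lang A, K ∈ C → L ∈ C → K ∪ L ∈ C) ∧
    (∀ K L : Lang A, K ∈ C → L ∈ C → K ∩ L ∈ C)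

/-- A Boolean algebra of languages: a lattice of languages closed under complement. -/
def IsBooleanAlgebraClass (C : LangClass A) : Prop :=
  IsLatticeClass C ∧ ∀ L ∈ C, Lᶜ ∈ C

/-- A class is quotient-closed if it is closed under left and right quotients by words. -/
def QuotientClosed (C : LangClass A) : Prop :=
  ∀ L ∈ C, ∀ u : FreeMonoid A,
    {w : FreeMonoid A | u * w ∈ L} ∈ C ∧ {w : FreeMonoid A | w * u ∈ L} ∈ C

/-- A language is regular if it is a preimage of a subset under a monoid morphism
into a finite monoid. -/
def IsRegularLang (L : Lang A) : Prop :=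
  ∃ (M : Type) (_ : Monoid M) (_ : Finite M) (φ : FreeMonoid A →* M) (F : Set M),
    L = φ ⁻¹' F

/-- A positive prevariety: a quotient-closed lattice of regular languages. -/
def IsPositivePrevariety (C : LangClass A) : Prop :=
  IsLatticeClass C ∧ QuotientClosed C ∧ ∀ L ∈ C, IsRegularLang L

/-- A prevariety: a quotient-closed Boolean algebra of regular languages. -/
def IsPrevariety (C : LangClass A) : Prop :=
  IsBooleanAlgebraClass C ∧ QuotientClosed C ∧ ∀ L ∈ C, IsRegularLang L

/-- The marked concatenation `KaL = {uav : u ∈ K, v ∈ L}`. -/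
def MarkedCat (K : Lang A) (a : A) (L : Lang A) : Lang A :=
  {w | ∃ u ∈ K, ∃ v ∈ L, w = u * FreeMonoid.of a * v}

/-- A marked concatenation `KaL` is unambiguous if every word of `KaL` has a
unique factorization `uav` with `u ∈ K` and `v ∈ L`. -/
def Unambiguous (K : Lang A) (a : A) (L : Lang A) : Prop :=
  ∀ u u' v v' : FreeMonoid A, u ∈ K → u' ∈ K → v ∈ L → v' ∈ L →
    u * FreeMonoid.of a * v = u' * FreeMonoid.of a * v' → u = u' ∧ v = v'

/-- The marked concatenation `KaL` is left deterministic: `K ∩ KaA* = ∅`. -/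
def LeftDeterministic (K : Lang A) (a : A) (_L : Lang A) : Prop :=
  K ∩ MarkedCat K a Set.univ = ∅

/-- The marked concatenation `KaL` is right deterministic: `L ∩ A*aL = ∅`. -/
def RightDeterministic (_K : Lang A) (a : A) (L : Lang A) : Prop :=
  L ∩ MarkedCat Set.univ a L = ∅

/-- Polynomial closure: the least class containing `C` and closed under binary
union and marked concatenation. -/
inductive Pol (C : LangClass A) : Lang A → Prop
  | base {L : Lang A} : L ∈ C → Pol C L
  | union {K L : Lang A} : Pol C K → Pol C L → Pol C (K ∪ L)
  | mcat {K L : Lang A} (a : A) : Pol C K → Pol C L → Pol C (MarkedCat K a L)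

/-- `coPol C`: the class of complements of languages in `Pol C`. -/
def coPol (C : LangClass A) : LangClass A := {L | ∃ K : Lang A, Pol C K ∧ L = Kᶜ}

/-- `BPol C`: the least Boolean algebra of languages containing `Pol C`. -/
inductive BPol (C : LangClass A) : Lang A → Prop
  | base {L : Lang A} : Pol C L → BPol C L
  | empty : BPol C ∅
  | univ : BPol C Set.univ
  | union {K L : Lang A} : BPol C K → BPol C L → BPol C (K ∪ L)
  | inter {K L : Lang A} : BPol C K → BPol C L → BPol C (K ∩ L)
  | compl {L : Lang A} : BPol C L → BPol C Lᶜ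

/-- Unambiguous polynomial closure: the least class containing `C` and closed
under disjoint union and unambiguous marked concatenation. -/
inductive UPol (C : LangClass A) : Lang A → Prop
  | base {L : Lang A} : L ∈ C → UPol C L
  | disjUnion {K L : Lang A} : UPol C K → UPol C L → K ∩ L = ∅ → UPol C (K ∪ L)
  | mcat {K L : Lang A} (a : A) : UPol C K → UPol C L → Unambiguous K a L →
      UPol C (MarkedCat K a L)

/-- Alternated polynomial closure: the least class containing `C` and closed under
disjoint union and left- and right-deterministic marked concatenation. -/
inductive APol (C : LangClass A) : Lang A → Prop
  | base {L : Lang A} : L ∈ C → APol C L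
  | disjUnion {K L : Lang A} : APol C K → APol C L → K ∩ L = ∅ → APol C (K ∪ L)
  | leftCat {K L : Lang A} (a : A) : APol C K → APol C L → LeftDeterministic K a L →
      APol C (MarkedCat K a L)
  | rightCat {K L : Lang A} (a : A) : APol C K → APol C L → RightDeterministic K a L →
      APol C (MarkedCat K a L)

/-- `KaL` is left `C`-deterministic: there are `K', L' ∈ C` with `K ⊆ K'`, `L ⊆ L'`
and `K'aL'` left deterministic. -/
def LeftCDeterministic (C : LangClass A) (K : Lang A) (a : A) (L : Lang A) : Prop :=
  ∃ K' ∈ C, ∃ L' ∈ C, K ⊆ K' ∧ L ⊆ L' ∧ LeftDeterministic K' a L'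

/-- `KaL` is right `C`-deterministic: there are `K', L' ∈ C` with `K ⊆ K'`, `L ⊆ L'`
and `K'aL'` right deterministic. -/
def RightCDeterministic (C : LangClass A) (K : Lang A) (a : A) (L : Lang A) : Prop :=
  ∃ K' ∈ C, ∃ L' ∈ C, K ⊆ K' ∧ L ⊆ L' ∧ RightDeterministic K' a L'

/-- Weak alternated polynomial closure: the least class containing `C` and closed under
disjoint union and left- and right-`C`-deterministic marked concatenation. -/
inductive WAPol (C : LangClass A) : Lang A → Prop
  | base {L : Lang A} : L ∈ C → WAPol C L
  | disjUnion {K L : Lang A} : WAPol C K → WAPol C L → K ∩ L = ∅ → WAPol C (K ∪ L)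
  | leftCat {K L : Lang A} (a : A) : WAPol C K → WAPol C L →
      LeftCDeterministic C K a L → WAPol C (MarkedCat K a L)
  | rightCat {K L : Lang A} (a : A) : WAPol C K → WAPol C L →
      RightCDeterministic C K a L → WAPol C (MarkedCat K a L)

/-- `K` separates `L₁` from `L₂`. -/
def Separates (K L₁ L₂ : Lang A) : Prop := L₁ ⊆ K ∧ K ∩ L₂ = ∅

/-- `L₁` is `C`-separable from `L₂`. -/
def Separable (C : LangClass A) (L₁ L₂ : Lang A) : Prop := ∃ K ∈ C, Separates K L₁ L₂

/-- `(s, t)` is a `C`-pair for `φ`: `φ⁻¹(s)` is not `C`-separable from `φ⁻¹(t)`. -/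
def CPair (C : LangClass A) {M : Type} [Monoid M] (φ : FreeMonoid A →* M)
    (s t : M) : Prop :=
  ¬ Separable C (φ ⁻¹' {s}) (φ ⁻¹' {t})

/-- The canonical `C`-preorder on `M` associated with `φ`. -/
def CPreorder (C : LangClass A) {M : Type} [Monoid M] (φ : FreeMonoid A →* M)
    (s t : M) : Prop :=
  ∀ F : Set M, φ ⁻¹' F ∈ C → s ∈ F → t ∈ F

/-- The canonical `C`-equivalence on `M` associated with `φ`. -/
def CEquiv (C : LangClass A) {M : Type} [Monoid M] (φ : FreeMonoid A →* M)
    (s t : M) : Prop :=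
  ∀ F : Set M, φ ⁻¹' F ∈ C → (s ∈ F ↔ t ∈ F)

/-- A `C`-morphism: a surjective morphism all of whose recognized languages are in `C`. -/
def IsCMorphism (C : LangClass A) {N : Type} [Monoid N] (η : FreeMonoid A →* N) : Prop :=
  Function.Surjective η ∧ ∀ F : Set N, η ⁻¹' F ∈ C

/-- `e` is the idempotent power `s^ω` of `s`: an idempotent of the form `s^n`, `n ≥ 1`
(in a finite monoid such an element exists and is unique). -/
def IsIdempotentPower {M : Type} [Monoid M] (s e : M) : Prop :=
  IsIdempotentElem e ∧ ∃ n : ℕ, 1 ≤ n ∧ e = s ^ n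

/-- The `C`-kernel of `φ`: the elements `s` such that `{ε}` is not `C`-separable
from `φ⁻¹(s)`. -/
def gKernel (C : LangClass A) {M : Type} [Monoid M] (φ : FreeMonoid A →* M) : Set M :=
  {s | ¬ Separable C ({1} : Lang A) (φ ⁻¹' {s})}

/-- The strict `C`-kernel of `φ`: the intersection of the `C`-kernel with `φ(A⁺)`. -/
def strictGKernel (C : LangClass A) {M : Type} [Monoid M]
    (φ : FreeMonoid A →* M) : Set M :=
  gKernel C φ ∩ φ '' {w : FreeMonoid A | w ≠ 1}

/-- A group language: one recognized by a morphism into a finite group. -/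
def IsGroupLanguage (L : Lang A) : Prop :=
  ∃ (G : Type) (_ : Group G) (_ : Finite G) (φ : FreeMonoid A →* G) (F : Set G),
    L = φ ⁻¹' F

/-- A prevariety of group languages. -/
def IsGroupPrevariety (G : LangClass A) : Prop :=
  IsPrevariety G ∧ ∀ L ∈ G, IsGroupLanguage L

/-- The well-suited extension `G⁺`: all languages `L ∩ A⁺` and `L ∪ {ε}` for `L ∈ G`. -/
def wellSuited (G : LangClass A) : LangClass A :=
  {L | ∃ K ∈ G, L = K ∩ {w : FreeMonoid A | w ≠ 1} ∨ L = K ∪ ({1} : Lang A)}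

/-- `le` is a partial order on the monoid `N` compatible with multiplication. -/
def IsCompatiblePartialOrder {N : Type} [Monoid N] (le : N → N → Prop) : Prop :=
  (∀ x, le x x) ∧ (∀ x y z, le x y → le y z → le x z) ∧
    (∀ x y, le x y → le y x → x = y) ∧
    (∀ x x' y y', le x y → le x' y' → le (x * x') (y * y'))

/-- `F` is upward closed for the relation `le`. -/
def UpClosed {N : Type} (le : N → N → Prop) (F : Set N) : Prop :=
  ∀ s ∈ F, ∀ t, le s t → t ∈ F

/-- An ordered `C`-morphism: a surjective morphism onto a finite ordered monoid such
that preimages of upward closed sets are in `C`. -/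
def IsOrderedCMorphism (C : LangClass A) {N : Type} [Monoid N]
    (η : FreeMonoid A →* N) (le : N → N → Prop) : Prop :=
  Function.Surjective η ∧ IsCompatiblePartialOrder le ∧
    ∀ F : Set N, UpClosed le F → η ⁻¹' F ∈ C

/-- The syntactic preorder of `L`: `u ≼_L v` iff `xuy ∈ L → xvy ∈ L` for all `x, y`. -/
def SynPre (L : Lang A) (u v : FreeMonoid A) : Prop :=
  ∀ x y : FreeMonoid A, x * u * y ∈ L → x * v * y ∈ L

/-- `φ` is (a copy of) the syntactic morphism of `L`: it is surjective and identifies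
exactly the words that are syntactically congruent for `L`. -/
def IsSyntacticMorphism (L : Lang A) {M : Type} [Monoid M]
    (φ : FreeMonoid A →* M) : Prop :=
  Function.Surjective φ ∧
    ∀ u v : FreeMonoid A, φ u = φ v ↔ ∀ x y : FreeMonoid A, (x * u * y ∈ L ↔ x * v * y ∈ L)

/-- `le` is (a copy of) the syntactic order of `L` on the target of `φ`. -/
def IsSyntacticOrder (L : Lang A) {M : Type} [Monoid M] (φ : FreeMonoid A →* M)
    (le : M → M → Prop) : Prop :=
  ∀ u v : FreeMonoid A, le (φ u) (φ v) ↔ SynPre L u v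

/-! ### Factorizations of words -/

theorem list_append_eq_append_cons {p r u v : List A} {a : A} (h : p ++ r = u ++ a :: v) :
    (∃ z, u = p ++ z ∧ r = z ++ a :: v) ∨ (∃ z, p = u ++ a :: z ∧ v = z ++ r) := by
  rcases List.append_eq_append_iff.1 h with ⟨z, h1, h2⟩ | ⟨z, h1, h2⟩
  · exact Or.inl ⟨z, h1, h2⟩
  · cases z with
    | nil => exact Or.inl ⟨[], by simpa using h1.symm, by simpa using h2.symm⟩
    | cons b z =>
      obtain ⟨rfl, h3⟩ := List.cons.inj h2
      exact Or.inr ⟨z, h1, h3⟩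

theorem mul_eq_mul_of_mul {p r u v : FreeMonoid A} {a : A}
    (h : p * r = u * FreeMonoid.of a * v) :
    (∃ z, u = p * z ∧ r = z * FreeMonoid.of a * v) ∨
      (∃ z, p = u * FreeMonoid.of a * z ∧ v = z * r) := by
  have h' := congrArg FreeMonoid.toList h
  simp only [FreeMonoid.toList_mul, FreeMonoid.toList_of, List.append_assoc,
    List.singleton_append] at h'
  refine (list_append_eq_append_cons h').imp ?_ ?_
  all_goals
    rintro ⟨z, h1, h2⟩
    refine ⟨FreeMonoid.ofList z, FreeMonoid.toList.injective ?_, FreeMonoid.toList.injective ?_⟩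
    · simpa using h1
    · simpa using h2

theorem of_mul_of_eq_cases {u v u' v' : FreeMonoid A} {a a' : A}
    (h : u * FreeMonoid.of a * v = u' * FreeMonoid.of a' * v') :
    (u = u' ∧ a = a' ∧ v = v') ∨
      (∃ z, u' = u * FreeMonoid.of a * z ∧ v = z * FreeMonoid.of a' * v') ∨
      (∃ z, u = u' * FreeMonoid.of a' * z ∧ v' = z * FreeMonoid.of a * v) := by
  rw [mul_assoc u] at h
  rcases mul_eq_mul_of_mul h with ⟨z, h1, h2⟩ | h
  · cases z using FreeMonoid.casesOn with
    | one =>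
      have h3 := congrArg FreeMonoid.toList h2
      simp only [one_mul, FreeMonoid.toList_mul, FreeMonoid.toList_of,
        List.singleton_append] at h3
      obtain ⟨h4, h5⟩ := List.cons.inj h3
      exact Or.inl ⟨by simpa using h1.symm, h4, FreeMonoid.toList.injective h5⟩
    | of_mul b z =>
      have h3 := congrArg FreeMonoid.toList h2
      simp only [mul_assoc, FreeMonoid.toList_mul, FreeMonoid.toList_of,
        List.singleton_append] at h3
      obtain ⟨rfl, h5⟩ := List.cons.inj h3
      exact Or.inr (Or.inl ⟨z, by rw [h1, mul_assoc],
        FreeMonoid.toList.injective (by simpa using h5)⟩)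
  · obtain ⟨z, h1, h2⟩ := h
    exact Or.inr (Or.inr ⟨z, h1, by rw [h2, mul_assoc]⟩)

theorem exists_first_exit (w : FreeMonoid A) :
    ∀ P : FreeMonoid A → Prop, P 1 → ¬ P w →
      ∃ u a v, w = u * FreeMonoid.of a * v ∧ P u ∧ ¬ P (u * FreeMonoid.of a) := by
  induction w using FreeMonoid.inductionOn' with
  | one => exact fun P h1 hw => absurd h1 hw
  | of_mul b w ih =>
    intro P h1 hw
    by_cases hb : P (FreeMonoid.of b)
    · obtain ⟨u, a, v, rfl, hu, hua⟩ :=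
        ih (fun x => P (FreeMonoid.of b * x)) (by simpa using hb) hw
      exact ⟨FreeMonoid.of b * u, a, v, by simp only [mul_assoc], hu,
        by simpa only [mul_assoc] using hua⟩
    · exact ⟨1, b, w, by simp, h1, by simpa using hb⟩

theorem exists_last_exit (w : FreeMonoid A) (P : FreeMonoid A → Prop) (h1 : P 1) (hw : ¬ P w) :
    ∃ u a v, w = u * FreeMonoid.of a * v ∧ P v ∧ ¬ P (FreeMonoid.of a * v) := by
  induction w using FreeMonoid.inductionOn' with
  | one => exact absurd h1 hw
  | of_mul b w ih =>
    by_cases hb : P w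
    · exact ⟨1, b, w, by simp, hb, hw⟩
    · obtain ⟨u, a, v, rfl, hv, hav⟩ := ih hb
      exact ⟨FreeMonoid.of b * u, a, v, by simp only [mul_assoc], hv, hav⟩

/-! ### Comparing the closure operators -/

theorem LeftDeterministic.unambiguous {K L : Lang A} {a : A} (h : LeftDeterministic K a L) :
    Unambiguous K a L := by
  intro u u' v v' hu hu' _ _ huv
  rcases of_mul_of_eq_cases huv with ⟨h1, _, h2⟩ | ⟨z, rfl, _⟩ | ⟨z, rfl, _⟩
  · exact ⟨h1, h2⟩
  · exact (Set.eq_empty_iff_forall_notMem.1 h _ ⟨hu', _, hu, z, trivial, rfl⟩).elim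
  · exact (Set.eq_empty_iff_forall_notMem.1 h _ ⟨hu, _, hu', z, trivial, rfl⟩).elim

theorem RightDeterministic.unambiguous {K L : Lang A} {a : A} (h : RightDeterministic K a L) :
    Unambiguous K a L := by
  intro u u' v v' _ _ hv hv' huv
  rcases of_mul_of_eq_cases huv with ⟨h1, _, h2⟩ | ⟨z, _, rfl⟩ | ⟨z, _, rfl⟩
  · exact ⟨h1, h2⟩
  · exact (Set.eq_empty_iff_forall_notMem.1 h _ ⟨hv, z, trivial, _, hv', rfl⟩).elim
  · exact (Set.eq_empty_iff_forall_notMem.1 h _ ⟨hv', z, trivial, _, hv, rfl⟩).elim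

theorem LeftCDeterministic.leftDeterministic {C : LangClass A} {K L : Lang A} {a : A}
    (h : LeftCDeterministic C K a L) : LeftDeterministic K a L := by
  obtain ⟨K', _, L', _, hK, _, h⟩ := h
  refine Set.eq_empty_iff_forall_notMem.2 ?_
  rintro w ⟨hw, u, hu, v, hv, rfl⟩
  exact Set.eq_empty_iff_forall_notMem.1 h _ ⟨hK hw, u, hK hu, v, hv, rfl⟩

theorem RightCDeterministic.rightDeterministic {C : LangClass A} {K L : Lang A} {a : A}
    (h : RightCDeterministic C K a L) : RightDeterministic K a L := by
  obtain ⟨K', _, L', _, _, hL, h⟩ := h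
  refine Set.eq_empty_iff_forall_notMem.2 ?_
  rintro w ⟨hw, u, hu, v, hv, rfl⟩
  exact Set.eq_empty_iff_forall_notMem.1 h _ ⟨hL hw, u, hu, v, hL hv, rfl⟩

theorem WAPol.apol {C : LangClass A} {L : Lang A} (h : WAPol C L) : APol C L := by
  induction h with
  | base h => exact .base h
  | disjUnion _ _ h ihK ihL => exact .disjUnion ihK ihL h
  | leftCat a _ _ h ihK ihL => exact .leftCat a ihK ihL h.leftDeterministic
  | rightCat a _ _ h ihK ihL => exact .rightCat a ihK ihL h.rightDeterministic

theorem APol.upol {C : LangClass A} {L : Lang A} (h : APol C L) : UPol C L := by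
  induction h with
  | base h => exact .base h
  | disjUnion _ _ h ihK ihL => exact .disjUnion ihK ihL h
  | leftCat a _ _ h ihK ihL => exact .mcat a ihK ihL h.unambiguous
  | rightCat a _ _ h ihK ihL => exact .mcat a ihK ihL h.unambiguous

theorem UPol.pol {C : LangClass A} {L : Lang A} (h : UPol C L) : Pol C L := by
  induction h with
  | base h => exact .base h
  | disjUnion _ _ _ ihK ihL => exact .union ihK ihL
  | mcat a _ _ _ ihK ihL => exact .mcat a ihK ihL

/-! ### Finite Boolean combinations and separation -/

theorem IsLatticeClass.iUnion_mem {C : LangClass A} (hC : IsLatticeClass C) {ι : Type}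
    [Finite ι] (f : ι → Lang A) (hf : ∀ i, f i ∈ C) : (⋃ i, f i) ∈ C := by
  have key : ∀ s : Set ι, s.Finite → (⋃ i ∈ s, f i) ∈ C := fun s hs => by
    induction s, hs using Set.Finite.induction_on with
    | empty => simpa using hC.1
    | insert _ _ ih =>
      rw [Set.biUnion_insert]
      exact hC.2.2.1 _ _ (hf _) ih
  simpa using key Set.univ Set.finite_univ

theorem IsLatticeClass.iInter_mem {C : LangClass A} (hC : IsLatticeClass C) {ι : Type}
    [Finite ι] (f : ι → Lang A) (hf : ∀ i, f i ∈ C) : (⋂ i, f i) ∈ C := by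
  have key : ∀ s : Set ι, s.Finite → (⋂ i ∈ s, f i) ∈ C := fun s hs => by
    induction s, hs using Set.Finite.induction_on with
    | empty => simpa using hC.2.1
    | insert _ _ ih =>
      rw [Set.biInter_insert]
      exact hC.2.2.2 _ _ (hf _) ih
  simpa using key Set.univ Set.finite_univ

theorem WAPol.iUnion {C : LangClass A} (hC : ∅ ∈ C) {ι : Type} [Finite ι] (f : ι → Lang A)
    (hf : ∀ i, WAPol C (f i)) (hd : ∀ i j w, w ∈ f i → w ∈ f j → i = j) :
    WAPol C (⋃ i, f i) := by
  have key : ∀ s : Set ι, s.Finite → WAPol C (⋃ i ∈ s, f i) := fun s hs => by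
    induction s, hs using Set.Finite.induction_on with
    | empty => simpa using WAPol.base hC
    | @insert i s hi _ ih =>
      rw [Set.biUnion_insert]
      refine .disjUnion (hf _) ih (Set.eq_empty_iff_forall_notMem.2 ?_)
      rintro w ⟨hw, hw'⟩
      simp only [Set.mem_iUnion] at hw'
      obtain ⟨j, hj, hw'⟩ := hw'
      obtain rfl := hd i j w hw hw'
      exact hi hj
  simpa using key Set.univ Set.finite_univ

section Morphism

variable {C : LangClass A} {M : Type} [Monoid M] {α : FreeMonoid A →* M}

theorem preimage_mem_of_separable [Finite M] (hC : IsLatticeClass C) (F : Set M)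
    (h : ∀ r ∈ F, ∀ r' ∉ F, Separable C (α ⁻¹' {r}) (α ⁻¹' {r'})) : α ⁻¹' F ∈ C := by
  choose K hKC hK using fun (r : F) (r' : (Fᶜ : Set M)) => h r r.2 r' r'.2
  have : α ⁻¹' F = ⋃ r : F, ⋂ r' : (Fᶜ : Set M), K r r' := by
    ext w
    simp only [Set.mem_iUnion, Set.mem_iInter]
    constructor
    · exact fun hw => ⟨⟨α w, hw⟩, fun r' => (hK _ r').1 rfl⟩
    · rintro ⟨r, hr⟩
      by_contra hw
      exact Set.eq_empty_iff_forall_notMem.1 (hK r ⟨α w, hw⟩).2 w ⟨hr _, rfl⟩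
  rw [this]
  exact hC.iUnion_mem _ fun r => hC.iInter_mem _ fun r' => hKC r r'

theorem CEquiv.refl (s : M) : CEquiv C α s s := fun _ _ => Iff.rfl

theorem CEquiv.symm {s t : M} (h : CEquiv C α s t) : CEquiv C α t s :=
  fun F hF => (h F hF).symm

theorem CEquiv.trans {s t r : M} (h : CEquiv C α s t) (h' : CEquiv C α t r) : CEquiv C α s r :=
  fun F hF => (h F hF).trans (h' F hF)

theorem CEquiv.mul (hC : QuotientClosed C) (hsurj : Function.Surjective α) {s t : M}
    (h : CEquiv C α s t) (x y : M) : CEquiv C α (x * s * y) (x * t * y) := by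
  intro F hF
  obtain ⟨u, rfl⟩ := hsurj x
  obtain ⟨v, rfl⟩ := hsurj y
  refine h {r | α u * r * α v ∈ F} ?_
  convert (hC _ (hC _ hF v).2 u).1 using 1
  ext w
  change _ ∈ F ↔ α (u * w * v) ∈ F
  rw [map_mul, map_mul]

theorem CEquiv.separable (hC : IsBooleanAlgebraClass C) {s t : M} (h : ¬ CEquiv C α s t) :
    Separable C (α ⁻¹' {s}) (α ⁻¹' {t}) := by
  simp only [CEquiv, not_forall] at h
  obtain ⟨F, hF, h⟩ := h
  by_cases hs : s ∈ F
  · have ht : t ∉ F := fun ht => h (iff_of_true hs ht)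
    refine ⟨_, hF, fun w hw => ?_, Set.eq_empty_iff_forall_notMem.2 ?_⟩
    · obtain rfl : α w = s := hw
      exact hs
    · rintro w ⟨hw, rfl⟩
      exact ht hw
  · have ht : t ∈ F := by
      by_contra ht
      exact h (iff_of_false hs ht)
    refine ⟨_, hC.2 _ hF, fun w hw => ?_, Set.eq_empty_iff_forall_notMem.2 ?_⟩
    · obtain rfl : α w = s := hw
      exact hs
    · rintro w ⟨hw, rfl⟩
      exact hw ht

theorem preimage_mem_of_saturated [Finite M] (hC : IsBooleanAlgebraClass C) (F : Set M)
    (h : ∀ r ∈ F, ∀ r', CEquiv C α r r' → r' ∈ F) : α ⁻¹' F ∈ C :=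
  preimage_mem_of_separable hC.1 F fun r hr r' hr' =>
    CEquiv.separable hC fun he => hr' (h r hr r' he)

theorem CPair.mul (hC : QuotientClosed C) (hsurj : Function.Surjective α) {s t : M}
    (h : CPair C α s t) (x y : M) : CPair C α (x * s * y) (x * t * y) := by
  rintro ⟨K, hK, h1, h2⟩
  obtain ⟨u, rfl⟩ := hsurj x
  obtain ⟨v, rfl⟩ := hsurj y
  refine h ⟨_, (hC _ (hC _ hK v).2 u).1, fun w hw => h1 ?_,
    Set.eq_empty_iff_forall_notMem.2 ?_⟩
  · obtain rfl : α w = s := hw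
    simp
  · rintro w ⟨hw, rfl⟩
    exact Set.eq_empty_iff_forall_notMem.1 h2 _ ⟨hw, by simp⟩

theorem CEquiv.reflTransGen [Finite M] (hC : IsLatticeClass C) {s t : M} (h : CEquiv C α s t) :
    Relation.ReflTransGen (CPair C α) s t := by
  refine (h {r | Relation.ReflTransGen (CPair C α) s r} ?_).1 .refl
  refine preimage_mem_of_separable hC _ fun r hr r' hr' => ?_
  by_contra hp
  exact hr' (Relation.ReflTransGen.tail hr hp)

theorem IsIdempotentPower.mul_comm {s e : M} (h : IsIdempotentPower s e) : e * s = s * e := by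
  obtain ⟨_, n, _, rfl⟩ := h
  rw [← pow_succ, ← pow_succ']

theorem IsIdempotentPower.mul_self {s e : M} (h : IsIdempotentPower s e) :
    IsIdempotentPower (e * s) e := by
  have hc : Commute e s := h.mul_comm
  obtain ⟨he, n, hn, hne⟩ := h
  refine ⟨he, n, hn, ?_⟩
  rw [hc.mul_pow, ← hne, he.pow_eq (by omega), he.eq]

theorem exists_isIdempotentPower [Finite M] (s : M) : ∃ e, IsIdempotentPower s e := by
  obtain ⟨i, j, hij, h⟩ := Finite.exists_ne_map_eq_of_infinite fun n : ℕ => s ^ n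
  wlog hlt : i < j generalizing i j
  · exact this j i hij.symm h.symm (by omega)
  obtain ⟨d, rfl⟩ := Nat.exists_eq_add_of_lt hlt
  have hper : ∀ k l : ℕ, s ^ (i + l + k * (d + 1)) = s ^ (i + l) := fun k l => by
    induction k with
    | zero => simp
    | succ k ih =>
      calc s ^ (i + l + (k + 1) * (d + 1)) = s ^ (i + d + 1) * s ^ (l + k * (d + 1)) := by
            rw [← pow_add]
            congr 1
            ring
        _ = s ^ (i + l + k * (d + 1)) := by
            rw [← h, ← pow_add, ← add_assoc]
        _ = s ^ (i + l) := ih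
  refine ⟨s ^ ((i + 1) * (d + 1)), ?_, (i + 1) * (d + 1), Nat.succ_le_of_lt (by positivity), rfl⟩
  have h1 := hper (i + 1) (i * d + d + 1)
  have h2 : i + (i * d + d + 1) = (i + 1) * (d + 1) := by ring
  rw [h2, pow_add] at h1
  exact h1

/-- The equation for `C`-pairs propagates along chains of `C`-pairs. -/
theorem eq_of_cequiv_of_forall_cpair [Finite M] (hC : IsPrevariety C)
    (hsurj : Function.Surjective α)
    (h : ∀ s t : M, CPair C α s t → ∀ e : M, IsIdempotentPower s e → e * s = e * t * e)
    {s t : M} (hst : CEquiv C α s t) {e : M} (he : IsIdempotentPower s e) :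
    e * s = e * t * e := by
  have hst' := hst.reflTransGen hC.1.1
  clear hst
  induction hst' with
  | refl => rw [mul_assoc, ← he.mul_comm, ← mul_assoc, he.1.eq]
  | @tail r r' _ hr ih =>
    have h1 := hr.mul hC.2.1 hsurj e e
    rw [← ih] at h1
    have h2 := h _ _ h1 e he.mul_self
    calc e * s = e * (e * s) := by rw [← mul_assoc, he.1.eq]
      _ = e * (e * r' * e) * e := h2
      _ = (e * e) * r' * (e * e) := by simp only [mul_assoc]
      _ = e * r' * e := by rw [he.1.eq]

end Morphism

/-! ### Pumping in polynomials of `C` -/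

/-- Every language of a prevariety is recognized by a morphism into a finite monoid which only
recognizes languages of that prevariety. -/
theorem exists_recognizing_morphism {C : LangClass A} (hC : IsPrevariety C) {L : Lang A}
    (hL : L ∈ C) :
    ∃ (N : Type) (_ : Monoid N) (_ : Finite N) (φ : FreeMonoid A →* N),
      (∀ F : Set N, φ ⁻¹' F ∈ C) ∧ ∀ u v, φ u = φ v → ∀ x y, x * u * y ∈ L → x * v * y ∈ L := by
  obtain ⟨M, _, _, ψ, G, hG⟩ := hC.2.2 L hL
  let c : Con (FreeMonoid A) :=
    { r := fun u v => ∀ x y, x * u * y ∈ L ↔ x * v * y ∈ L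
      iseqv := ⟨fun _ _ _ => Iff.rfl, fun h x y => (h x y).symm,
        fun h h' x y => (h x y).trans (h' x y)⟩
      mul' := by
        intro u u' v v' h h' x y
        have h1 := h x (v * y)
        have h2 := h' (x * u') y
        simp only [mul_assoc] at h1 h2 ⊢
        exact h1.trans h2 }
  have hc : ∀ u v, c u v ↔ ∀ x y, x * u * y ∈ L ↔ x * v * y ∈ L := fun _ _ => Iff.rfl
  have hfin : Finite c.Quotient := by
    refine Finite.of_injective (fun q : c.Quotient => ψ q.out) fun q q' h => ?_
    rw [← Quotient.out_eq q, ← Quotient.out_eq q']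
    refine (Con.eq c).2 ((hc _ _).2 fun x y => ?_)
    have h' : ψ q.out = ψ q'.out := h
    simp only [hG, Set.mem_preimage, map_mul, h']
  refine ⟨c.Quotient, inferInstance, hfin, c.mk', fun F => ?_, fun u v h x y => ?_⟩
  · refine preimage_mem_of_separable hC.1.1 F fun r hr r' hr' => ?_
    induction r using Con.induction_on with | H u => ?_
    induction r' using Con.induction_on with | H v => ?_
    have huv : ¬ c u v := fun h => hr' ((Con.eq c).2 h ▸ hr)
    simp only [hc, not_forall] at huv
    obtain ⟨x, y, hxy⟩ := huv
    have hQ : {w | x * w * y ∈ L} ∈ C := by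
      exact (hC.2.1 _ (hC.2.1 L hL y).2 x).1
    have hinv : ∀ w w' : FreeMonoid A, c.mk' w = (w' : c.Quotient) →
        (x * w * y ∈ L ↔ x * w' * y ∈ L) := fun w w' h => (Con.eq c).1 h x y
    by_cases hu : x * u * y ∈ L
    · have hv : x * v * y ∉ L := fun hv => hxy (iff_of_true hu hv)
      exact ⟨_, hQ, fun w hw => (hinv w u hw).2 hu,
        Set.eq_empty_iff_forall_notMem.2 fun w hw => hv ((hinv w v hw.2).1 hw.1)⟩
    · have hv : x * v * y ∈ L := by
        by_contra hv
        exact hxy (iff_of_false hu hv)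
      exact ⟨_, hC.1.2 _ hQ, fun w hw hwL => hu ((hinv w u hw).1 hwL),
        Set.eq_empty_iff_forall_notMem.2 fun w hw => hw.1 ((hinv w v hw.2).2 hv)⟩
  · exact ((Con.eq c).1 h x y).1

theorem preimage_prod_mem {C : LangClass A} (hC : IsLatticeClass C) {N₁ N₂ : Type} [Monoid N₁]
    [Monoid N₂] [Finite N₁] [Finite N₂] (φ₁ : FreeMonoid A →* N₁) (φ₂ : FreeMonoid A →* N₂)
    (h₁ : ∀ F, φ₁ ⁻¹' F ∈ C) (h₂ : ∀ F, φ₂ ⁻¹' F ∈ C) (F : Set (N₁ × N₂)) :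
    φ₁.prod φ₂ ⁻¹' F ∈ C := by
  have : φ₁.prod φ₂ ⁻¹' F = ⋃ r : F, φ₁ ⁻¹' {r.1.1} ∩ φ₂ ⁻¹' {r.1.2} := by
    ext w
    simp only [Set.mem_iUnion]
    constructor
    · exact fun hw => ⟨⟨_, hw⟩, rfl, rfl⟩
    · rintro ⟨⟨⟨a, b⟩, hr⟩, ha, hb⟩
      obtain rfl : φ₁ w = a := ha
      obtain rfl : φ₂ w = b := hb
      exact hr
  rw [this]
  exact hC.iUnion_mem _ fun r => hC.2.2.2 _ _ (h₁ _) (h₂ _)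

/-- In a long enough power `E ^ n` occurring in a word of a language of `Pol C`, one of the copies
of `E` can be replaced by any word having the same image under some fixed `C`-morphism. -/
theorem Pol.exists_pumping {C : LangClass A} (hC : IsPrevariety C) {L : Lang A} (hL : Pol C L) :
    ∃ (N : Type) (_ : Monoid N) (_ : Finite N) (φ : FreeMonoid A →* N) (n : ℕ),
      (∀ F : Set N, φ ⁻¹' F ∈ C) ∧ ∀ E x y : FreeMonoid A, x * E ^ n * y ∈ L →
        ∃ i j, ∀ X, φ X = φ E → x * E ^ i * X * E ^ j * y ∈ L := by
  induction hL with
  | base hL =>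
    obtain ⟨N, _, _, φ, hφ, h⟩ := exists_recognizing_morphism hC hL
    refine ⟨N, _, ‹_›, φ, 1, hφ, fun E x y hE => ⟨0, 0, fun X hX => ?_⟩⟩
    simpa using h E X hX.symm x y (by simpa using hE)
  | union _ _ ihK ihL =>
    obtain ⟨N₁, _, _, φ₁, n₁, hφ₁, h₁⟩ := ihK
    obtain ⟨N₂, _, _, φ₂, n₂, hφ₂, h₂⟩ := ihL
    refine ⟨N₁ × N₂, inferInstance, inferInstance, φ₁.prod φ₂, n₁ + n₂,
      preimage_prod_mem hC.1.1 φ₁ φ₂ hφ₁ hφ₂, fun E x y hE => ?_⟩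
    rcases hE with hE | hE
    · obtain ⟨i, j, h⟩ := h₁ E x (E ^ n₂ * y) (by simpa only [pow_add, mul_assoc] using hE)
      refine ⟨i, j + n₂, fun X hX => Or.inl ?_⟩
      simpa only [pow_add, mul_assoc] using h X (congrArg Prod.fst hX)
    · obtain ⟨i, j, h⟩ := h₂ E (x * E ^ n₁) y (by simpa only [pow_add, mul_assoc] using hE)
      refine ⟨n₁ + i, j, fun X hX => Or.inr ?_⟩
      simpa only [pow_add, mul_assoc] using h X (congrArg Prod.snd hX)
  | mcat a _ _ ihK ihL =>
    obtain ⟨N₁, _, _, φ₁, n₁, hφ₁, h₁⟩ := ihK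
    obtain ⟨N₂, _, _, φ₂, n₂, hφ₂, h₂⟩ := ihL
    refine ⟨N₁ × N₂, inferInstance, inferInstance, φ₁.prod φ₂, n₁ + n₂,
      preimage_prod_mem hC.1.1 φ₁ φ₂ hφ₁ hφ₂, fun E x y hE => ?_⟩
    obtain ⟨u, hu, v, hv, huv⟩ := hE
    have huv' : (x * E ^ n₁) * (E ^ n₂ * y) = u * FreeMonoid.of a * v := by
      simpa only [pow_add, mul_assoc] using huv
    rcases mul_eq_mul_of_mul huv' with ⟨z, rfl, hz⟩ | ⟨z, hz, rfl⟩
    · obtain ⟨i, j, h⟩ := h₁ E x z hu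
      refine ⟨i, j + n₂, fun X hX => ⟨_, h X (congrArg Prod.fst hX), v, hv, ?_⟩⟩
      simp only [pow_add, mul_assoc] at hz ⊢
      rw [hz]
    · obtain ⟨i, j, h⟩ := h₂ E z y (by simpa only [mul_assoc] using hv)
      refine ⟨n₁ + i, j, fun X hX => ⟨u, hu, _, h X (congrArg Prod.snd hX), ?_⟩⟩
      rw [pow_add, ← mul_assoc x, hz]
      simp only [mul_assoc]

theorem CPair.exists_eq {C : LangClass A} {M : Type} [Monoid M] {α : FreeMonoid A →* M} {s t : M}
    (h : CPair C α s t) {N : Type} [Monoid N] {φ : FreeMonoid A →* N}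
    (hφ : ∀ F : Set N, φ ⁻¹' F ∈ C) : ∃ u v, α u = s ∧ α v = t ∧ φ u = φ v := by
  by_contra hn
  refine h ⟨_, hφ (φ '' (α ⁻¹' {s})), Set.subset_preimage_image _ _,
    Set.eq_empty_iff_forall_notMem.2 ?_⟩
  rintro v ⟨⟨u, hu, huv⟩, hv⟩
  exact hn ⟨u, v, hu, hv, huv⟩

theorem eq_of_cpair_of_pol {C : LangClass A} (hC : IsPrevariety C) {M : Type} [Monoid M]
    {α : FreeMonoid A →* M} (hα : ∀ F : Set M, Pol C (α ⁻¹' F)) {s t : M} (h : CPair C α s t)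
    {e : M} (he : IsIdempotentPower s e) : e * s = e * t * e := by
  obtain ⟨N, _, _, φ, n, hφ, hpump⟩ := (hα {e * s}).exists_pumping hC
  obtain ⟨u, v, rfl, rfl, huv⟩ := h.exists_eq hφ
  have hcomm := he.mul_comm
  obtain ⟨f, hf, q, hq, hfq⟩ := exists_isIdempotentPower (φ u)
  obtain ⟨he, p, hp, hep⟩ := he
  obtain ⟨r, hr⟩ : ∃ r, p * q = r + 1 := Nat.exists_eq_succ_of_ne_zero (by positivity)
  have hαE : α (u ^ (r + 1)) = e := by
    rw [map_pow, ← hr, pow_mul, ← hep, he.pow_eq (by omega)]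
  have hφE : φ (u ^ (r + 1)) = f := by
    rw [map_pow, ← hr, mul_comm, pow_mul, ← hfq, hf.pow_eq (by omega)]
  have hαr : α u ^ r * α u = e := by rw [← pow_succ, ← map_pow, hαE]
  have hφr : φ u * φ u ^ r = f := by rw [← pow_succ', ← map_pow, hφE]
  have hepow : ∀ k : ℕ, e * e ^ k = e := fun k => by
    rw [← pow_succ', he.pow_eq (by omega)]
  obtain ⟨i, j, hij⟩ := hpump (u ^ (r + 1)) (u ^ (r + 1)) u (by
    rw [Set.mem_preimage, Set.mem_singleton_iff, map_mul, map_mul, map_pow α _ n, hαE,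
      hepow])
  have hX := hij (u ^ (r + 1) * v * u ^ r) (by
    rw [map_mul, map_mul, hφE, ← huv, map_pow, mul_assoc, hφr, hf.eq])
  rw [Set.mem_preimage, Set.mem_singleton_iff] at hX
  simp only [map_mul, map_pow] at hX hαE
  have hej : Commute (e ^ j) (α u) := Commute.pow_left hcomm j
  calc e * α u = _ := hX.symm
    _ = (e * e ^ i) * e * α v * α u ^ r * (e ^ j * α u) := by simp only [hαE, mul_assoc]
    _ = e * α v * ((α u ^ r * α u) * e ^ j) := by
      rw [hej.eq, hepow, he.eq]
      simp only [mul_assoc]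
    _ = e * α v * e := by rw [hαr, hepow]

/-! ### From the equation to weak alternated polynomials -/

theorem mul_pow_eq_self {M : Type} [Monoid M] {p g : M} (h : p * g = p) (n : ℕ) : p * g ^ n = p := by
  induction n with
  | zero => rw [pow_zero, mul_one]
  | succ n ih => rw [pow_succ, ← mul_assoc, ih, h]

theorem pow_mul_eq_self {M : Type} [Monoid M] {p g : M} (h : g * p = p) (n : ℕ) : g ^ n * p = p := by
  induction n with
  | zero => rw [pow_zero, one_mul]
  | succ n ih => rw [pow_succ, mul_assoc, h, ih]

section Equation

variable {C : LangClass A} {M : Type} [Monoid M] [Finite M] {α : FreeMonoid A →* M}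

theorem mul_eq_of_cequiv_of_staying (hC : QuotientClosed C) (hsurj : Function.Surjective α)
    (h : ∀ s t : M, CEquiv C α s t → ∀ e : M, IsIdempotentPower s e → e * s = e * t * e)
    {p q m m' t z z' : M} (hm : p * m * q = t) (hz : t * z = p) (hz' : z' * t = q)
    (hmm' : CEquiv C α m m') : p * m' * q = t := by
  obtain ⟨e, he⟩ := exists_isIdempotentPower (m * q * z)
  have hs := h _ _ (by simpa only [one_mul, mul_assoc] using hmm'.mul hC hsurj 1 (q * z)) e he
  obtain ⟨-, n, -, rfl⟩ := he
  have hp : p * (m * q * z) = p := by rw [← mul_assoc, ← mul_assoc p, hm, hz]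
  have hpn : p * (m * q * z) ^ n = p := mul_pow_eq_self hp n
  have hq : q * z * m * q = q := by
    calc q * z * m * q = z' * (t * z) * m * q := by rw [← mul_assoc, hz']
      _ = z' * (p * m * q) := by rw [hz]; simp only [mul_assoc]
      _ = q := by rw [hm, hz']
  have hqn : ∀ k : ℕ, q * z * (m * q * z) ^ k * m * q = q := fun k => by
    induction k with
    | zero => rw [pow_zero, mul_one, hq]
    | succ k ih =>
      calc q * z * (m * q * z) ^ (k + 1) * m * q
          = (q * z * m * q) * z * (m * q * z) ^ k * m * q := by
            rw [pow_succ']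
            simp only [mul_assoc]
        _ = q := by rw [hq, ih]
  calc p * m' * q = p * m' * (q * z * (m * q * z) ^ n * m * q) := by rw [hqn]
    _ = p * (m * q * z) ^ n * m' * (q * z * (m * q * z) ^ n * m * q) := by rw [hpn]
    _ = p * ((m * q * z) ^ n * (m' * (q * z)) * (m * q * z) ^ n) * m * q := by
      simp only [mul_assoc]
    _ = p * (m * q * z) ^ n * (m * q * z) * m * q := by rw [← hs]; simp only [mul_assoc]
    _ = t := by rw [hpn, hp, hm]

/-- If `a` makes the state `p` leave its `𝓡`-class after reading `r`, then `α⁻¹(r)` followed by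
`a` is left `C`-deterministic. -/
theorem leftCDeterministic_of_exit (hC : IsPrevariety C) (hsurj : Function.Surjective α)
    (h : ∀ s t : M, CEquiv C α s t → ∀ e : M, IsIdempotentPower s e → e * s = e * t * e)
    {p r z : M} {a : A} (hr : p * r * z = p)
    (ha : ¬ ∃ z, p * r * α (FreeMonoid.of a) * z = p) (L : Lang A) :
    LeftCDeterministic C (α ⁻¹' {r}) a L := by
  refine ⟨α ⁻¹' {r' | CEquiv C α r r'},
    preimage_mem_of_saturated hC.1 _ fun _ h1 _ h2 => h1.trans h2, Set.univ, hC.1.1.2.1, ?_,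
    Set.subset_univ _, Set.eq_empty_iff_forall_notMem.2 ?_⟩
  · rintro w rfl
    exact CEquiv.refl _
  rintro w ⟨hw, u, hu, v, -, rfl⟩
  have h1 : CEquiv C α r (r * (α (FreeMonoid.of a) * α v)) := by
    have h2 := CEquiv.mul hC.2.1 hsurj hu.symm 1 (α (FreeMonoid.of a) * α v)
    rw [one_mul, one_mul] at h2
    have h3 : CEquiv C α r (α u * (α (FreeMonoid.of a) * α v)) := by
      rw [← map_mul, ← map_mul, ← mul_assoc]
      exact hw
    exact h3.trans h2
  have h2 := h1.mul hC.2.1 hsurj z 1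
  simp only [mul_one] at h2
  obtain ⟨e, he⟩ := exists_isIdempotentPower (z * r)
  have hs := h _ _ h2 e he
  obtain ⟨-, n, -, rfl⟩ := he
  have hp : p * r * (z * r) = p * r := by rw [← mul_assoc, hr]
  have hpn := mul_pow_eq_self hp n
  refine ha ⟨α v * (z * r) ^ n * z, ?_⟩
  calc p * r * α (FreeMonoid.of a) * (α v * (z * r) ^ n * z)
      = (p * r * z) * (r * (α (FreeMonoid.of a) * α v)) * (z * r) ^ n * z := by
        rw [hr]
        simp only [mul_assoc]
    _ = (p * r * (z * r) ^ n) * z * (r * (α (FreeMonoid.of a) * α v)) * (z * r) ^ n * z := by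
        rw [hpn]
    _ = p * r * ((z * r) ^ n * (z * (r * (α (FreeMonoid.of a) * α v))) * (z * r) ^ n) * z := by
        simp only [mul_assoc]
    _ = (p * r * (z * r) ^ n) * (z * r) * z := by
        rw [← hs]
        simp only [mul_assoc]
    _ = p := by rw [hpn, hp, hr]

/-- The left-right dual of `leftCDeterministic_of_exit`. -/
theorem rightCDeterministic_of_exit (hC : IsPrevariety C) (hsurj : Function.Surjective α)
    (h : ∀ s t : M, CEquiv C α s t → ∀ e : M, IsIdempotentPower s e → e * s = e * t * e)
    {q r z : M} {a : A} (hr : z * (r * q) = q)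
    (ha : ¬ ∃ z, z * (α (FreeMonoid.of a) * (r * q)) = q) (K : Lang A) :
    RightCDeterministic C K a (α ⁻¹' {r}) := by
  refine ⟨Set.univ, hC.1.1.2.1, α ⁻¹' {r' | CEquiv C α r r'},
    preimage_mem_of_saturated hC.1 _ fun _ h1 _ h2 => h1.trans h2, Set.subset_univ _, ?_,
    Set.eq_empty_iff_forall_notMem.2 ?_⟩
  · rintro w rfl
    exact CEquiv.refl _
  rintro w ⟨hw, v, -, u, hu, rfl⟩
  have h1 : CEquiv C α r (α v * α (FreeMonoid.of a) * r) := by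
    have h2 := CEquiv.mul hC.2.1 hsurj hu.symm (α v * α (FreeMonoid.of a)) 1
    rw [mul_one, mul_one] at h2
    have h3 : CEquiv C α r (α v * α (FreeMonoid.of a) * α u) := by
      rw [← map_mul, ← map_mul]
      exact hw
    exact h3.trans h2
  have h2 := h1.mul hC.2.1 hsurj 1 z
  simp only [one_mul] at h2
  obtain ⟨e, he⟩ := exists_isIdempotentPower (r * z)
  have hs := h _ _ h2 e he
  obtain ⟨-, n, -, rfl⟩ := he
  have hp : r * z * (r * q) = r * q := by rw [mul_assoc, hr]
  have hpn := pow_mul_eq_self hp n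
  refine ha ⟨z * (r * z) ^ n * α v, ?_⟩
  calc z * (r * z) ^ n * α v * (α (FreeMonoid.of a) * (r * q))
      = z * (r * z) ^ n * (α v * α (FreeMonoid.of a) * r) * (z * (r * q)) := by
        rw [hr]
        simp only [mul_assoc]
    _ = z * (r * z) ^ n * (α v * α (FreeMonoid.of a) * r) * (z * ((r * z) ^ n * (r * q))) := by
        rw [hpn]
    _ = z * ((r * z) ^ n * (α v * α (FreeMonoid.of a) * r * z) * (r * z) ^ n) * (r * q) := by
        simp only [mul_assoc]
    _ = z * ((r * z) ^ n * (r * z * (r * q))) := by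
        rw [← hs]
        simp only [mul_assoc]
    _ = q := by rw [hp, hpn, hr]

/-- Two-sided divisibility together with `𝓡`-divisibility gives `𝓡`-equivalence. -/
theorem exists_mul_eq_of_mul_mul {s t x y z : M} (h1 : s * x = t) (h2 : y * t * z = s) :
    ∃ w, t * w = s := by
  obtain ⟨e, he, n, hn, rfl⟩ := exists_isIdempotentPower y
  have hk : ∀ k : ℕ, y ^ k * s * (x * z) ^ k = s := fun k => by
    induction k with
    | zero => simp
    | succ k ih =>
      calc y ^ (k + 1) * s * (x * z) ^ (k + 1) = y ^ k * (y * (s * x) * z) * (x * z) ^ k := by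
            rw [pow_succ, pow_succ']
            simp only [mul_assoc]
        _ = s := by rw [h1, h2, ih]
  have hys : y ^ n * s = s := by
    calc y ^ n * s = (y ^ n * y ^ n) * s * (x * z) ^ n := by
          nth_rw 1 [← hk n]
          simp only [mul_assoc]
      _ = s := by rw [he.eq, hk]
  obtain ⟨k, rfl⟩ := Nat.exists_eq_succ_of_ne_zero (by omega : n ≠ 0)
  refine ⟨z * (x * z) ^ k, ?_⟩
  calc t * (z * (x * z) ^ k) = s * (x * z) ^ (k + 1) := by
        rw [← h1, pow_succ']
        simp only [mul_assoc]
    _ = y ^ (k + 1) * s * (x * z) ^ (k + 1) := by rw [hys]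
    _ = s := hk _

/-- Two-sided divisibility together with `𝓛`-divisibility gives `𝓛`-equivalence. -/
theorem exists_mul_eq_of_mul_mul' {s t x y z : M} (h1 : x * s = t) (h2 : y * t * z = s) :
    ∃ w, w * t = s := by
  have : Finite Mᵐᵒᵖ := Finite.of_equiv M MulOpposite.opEquiv
  obtain ⟨w, hw⟩ := exists_mul_eq_of_mul_mul (M := Mᵐᵒᵖ) (s := .op s) (t := .op t) (x := .op x)
    (y := .op z) (z := .op y) (congrArg MulOpposite.op h1)
    (congrArg MulOpposite.op ((mul_assoc y t z).symm.trans h2))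
  exact ⟨w.unop, congrArg MulOpposite.unop hw⟩

/-- The words leading from the context `(p, q)` to `t` form a weak alternated polynomial if this
holds for all elements strictly `𝓙`-above `t`, and for all contexts obtained from `(p, q)` by
leaving the `𝓡`-class of `p` to the right. -/
theorem wapol_of_left_exit [Finite A] (hC : IsPrevariety C) (hsurj : Function.Surjective α)
    (h : ∀ s t : M, CEquiv C α s t → ∀ e : M, IsIdempotentPower s e → e * s = e * t * e)
    {p q t : M} (hp : ¬ ∃ z, t * z = p)
    (ihJ : ∀ r, (∃ x y, x * r * y = t) → (¬ ∃ x y, x * t * y = r) → WAPol C (α ⁻¹' {r}))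
    (ihR : ∀ x, (¬ ∃ z, p * x * z = p) → WAPol C (α ⁻¹' {m | p * x * m * q = t})) :
    WAPol C (α ⁻¹' {m | p * m * q = t}) := by
  have hJ : ∀ r z v : M, p * r * z = p → p * r * v = t → WAPol C (α ⁻¹' {r}) := by
    intro r z v hr hv
    refine ihJ r ⟨_, _, hv⟩ ?_
    rintro ⟨x, y, rfl⟩
    refine hp (exists_mul_eq_of_mul_mul (x := x * t * y * v) (y := p * x) (z := y * z) ?_ ?_)
    · simpa only [mul_assoc] using hv
    · simpa only [mul_assoc] using hr
  let I := {r : M // (∃ z, p * r * z = p) ∧ p * r * q = t}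
  let J := {ra : M × A // (∃ z, p * ra.1 * z = p) ∧
    (¬ ∃ z, p * ra.1 * α (FreeMonoid.of ra.2) * z = p) ∧ ∃ v, p * ra.1 * v = t}
  let f : I → Lang A := fun r => α ⁻¹' {r.1}
  let g : J → Lang A := fun ra => MarkedCat (α ⁻¹' {ra.1.1}) ra.1.2
    (α ⁻¹' {m | p * (ra.1.1 * α (FreeMonoid.of ra.1.2)) * m * q = t})
  have heq : α ⁻¹' {m | p * m * q = t} = (⋃ i, f i) ∪ ⋃ j, g j := by
    ext w
    simp only [Set.mem_union, Set.mem_iUnion]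
    constructor
    · intro hw
      have hw : p * α w * q = t := hw
      by_cases hst : ∃ z, p * α w * z = p
      · exact Or.inl ⟨⟨α w, hst, hw⟩, rfl⟩
      · obtain ⟨u, a, v, rfl, hu, hua⟩ := exists_first_exit w (fun w => ∃ z, p * α w * z = p)
          ⟨1, by simp⟩ hst
        simp only [map_mul] at hua hw
        refine Or.inr ⟨⟨(α u, a), hu, ?_, α (FreeMonoid.of a) * α v * q, ?_⟩,
          u, rfl, v, ?_, rfl⟩
        · simpa only [mul_assoc] using hua
        · simpa only [mul_assoc] using hw
        · change p * (α u * α (FreeMonoid.of a)) * α v * q = t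
          simpa only [mul_assoc] using hw
    · rintro (⟨⟨r, hr, hrt⟩, hw⟩ | ⟨⟨⟨r, a⟩, hr⟩, u, hu, v, hv, rfl⟩)
      · obtain rfl : α w = r := hw
        exact hrt
      · obtain rfl : α u = r := hu
        have hv : p * (α u * α (FreeMonoid.of a)) * α v * q = t := hv
        change p * α (u * FreeMonoid.of a * v) * q = t
        simpa only [map_mul, mul_assoc] using hv
  have hexit : ∀ u z : FreeMonoid A, ∀ a,
      (¬ ∃ z, p * α u * α (FreeMonoid.of a) * z = p) →
        ¬ ∃ y, p * α (u * FreeMonoid.of a * z) * y = p := by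
    rintro u z a hn ⟨y, hy⟩
    exact hn ⟨α z * y, by simpa only [map_mul, mul_assoc] using hy⟩
  rw [heq]
  refine .disjUnion (WAPol.iUnion hC.1.1.1 _ ?_ ?_) (WAPol.iUnion hC.1.1.1 _ ?_ ?_) ?_
  · rintro ⟨r, ⟨z, hr⟩, hrt⟩
    exact hJ r z q hr hrt
  · rintro ⟨r, hr⟩ ⟨r', hr'⟩ w hw hw'
    obtain rfl : α w = r := hw
    obtain rfl : α w = r' := hw'
    rfl
  · rintro ⟨⟨r, a⟩, ⟨z, hr⟩, ha, v, hv⟩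
    refine .leftCat a (hJ r z v hr hv) (ihR _ ?_) (leftCDeterministic_of_exit hC hsurj h hr ha _)
    simpa only [mul_assoc] using ha
  · rintro ⟨⟨r, a⟩, hr, hra, _⟩ ⟨⟨r', a'⟩, hr', hra', _⟩ w ⟨u, hu, v, hv, rfl⟩
      ⟨u', hu', v', hv', hw⟩
    obtain rfl : α u = r := hu
    obtain rfl : α u' = r' := hu'
    rcases of_mul_of_eq_cases hw with ⟨rfl, rfl, _⟩ | ⟨z, rfl, _⟩ | ⟨z, rfl, _⟩
    · rfl
    · exact (hexit _ _ _ hra hr').elim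
    · exact (hexit _ _ _ hra' hr).elim
  · refine Set.eq_empty_iff_forall_notMem.2 ?_
    rintro w ⟨hw, hw'⟩
    simp only [Set.mem_iUnion] at hw hw'
    obtain ⟨⟨r, hr, _⟩, hw⟩ := hw
    obtain ⟨⟨⟨r', a⟩, _, hra, _⟩, u, hu, v, _, rfl⟩ := hw'
    obtain rfl : α _ = r := hw
    obtain rfl : α u = r' := hu
    exact hexit _ _ _ hra hr

/-- The left-right dual of `wapol_of_left_exit`. -/
theorem wapol_of_right_exit [Finite A] (hC : IsPrevariety C) (hsurj : Function.Surjective α)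
    (h : ∀ s t : M, CEquiv C α s t → ∀ e : M, IsIdempotentPower s e → e * s = e * t * e)
    {p q t : M} (hq : ¬ ∃ z, z * t = q)
    (ihJ : ∀ r, (∃ x y, x * r * y = t) → (¬ ∃ x y, x * t * y = r) → WAPol C (α ⁻¹' {r}))
    (ihL : ∀ x, (¬ ∃ z, z * (x * q) = q) → WAPol C (α ⁻¹' {m | p * m * (x * q) = t})) :
    WAPol C (α ⁻¹' {m | p * m * q = t}) := by
  have hJ : ∀ r z v : M, z * (r * q) = q → v * (r * q) = t → WAPol C (α ⁻¹' {r}) := by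
    intro r z v hr hv
    refine ihJ r ⟨v, q, by rw [mul_assoc, hv]⟩ ?_
    rintro ⟨x, y, rfl⟩
    refine hq (exists_mul_eq_of_mul_mul' (x := v * (x * t * y)) (y := z * x) (z := y * q) ?_ ?_)
    · simpa only [mul_assoc] using hv
    · simpa only [mul_assoc] using hr
  let I := {r : M // (∃ z, z * (r * q) = q) ∧ p * r * q = t}
  let J := {ra : M × A // (∃ z, z * (ra.1 * q) = q) ∧
    (¬ ∃ z, z * (α (FreeMonoid.of ra.2) * (ra.1 * q)) = q) ∧ ∃ v, v * (ra.1 * q) = t}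
  let f : I → Lang A := fun r => α ⁻¹' {r.1}
  let g : J → Lang A := fun ra => MarkedCat
    (α ⁻¹' {m | p * m * (α (FreeMonoid.of ra.1.2) * ra.1.1 * q) = t}) ra.1.2 (α ⁻¹' {ra.1.1})
  have heq : α ⁻¹' {m | p * m * q = t} = (⋃ i, f i) ∪ ⋃ j, g j := by
    ext w
    simp only [Set.mem_union, Set.mem_iUnion]
    constructor
    · intro hw
      have hw : p * α w * q = t := hw
      by_cases hst : ∃ z, z * (α w * q) = q
      · exact Or.inl ⟨⟨α w, hst, hw⟩, rfl⟩
      · obtain ⟨v, a, u, rfl, hu, hua⟩ := exists_last_exit w (fun w => ∃ z, z * (α w * q) = q)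
          ⟨1, by simp⟩ hst
        simp only [map_mul] at hua hw
        refine Or.inr ⟨⟨(α u, a), hu, ?_, p * α v * α (FreeMonoid.of a), ?_⟩,
          v, ?_, u, rfl, rfl⟩
        · simpa only [mul_assoc] using hua
        · simpa only [mul_assoc] using hw
        · change p * α v * (α (FreeMonoid.of a) * α u * q) = t
          simpa only [mul_assoc] using hw
    · rintro (⟨⟨r, hr, hrt⟩, hw⟩ | ⟨⟨⟨r, a⟩, hr⟩, v, hv, u, hu, rfl⟩)
      · obtain rfl : α w = r := hw
        exact hrt
      · obtain rfl : α u = r := hu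
        have hv : p * α v * (α (FreeMonoid.of a) * α u * q) = t := hv
        change p * α (v * FreeMonoid.of a * u) * q = t
        simpa only [map_mul, mul_assoc] using hv
  have hexit : ∀ u z : FreeMonoid A, ∀ a,
      (¬ ∃ z, z * (α (FreeMonoid.of a) * (α u * q)) = q) →
        ¬ ∃ y, y * (α (z * FreeMonoid.of a * u) * q) = q := by
    rintro u z a hn ⟨y, hy⟩
    exact hn ⟨y * α z, by simpa only [map_mul, mul_assoc] using hy⟩
  rw [heq]
  refine .disjUnion (WAPol.iUnion hC.1.1.1 _ ?_ ?_) (WAPol.iUnion hC.1.1.1 _ ?_ ?_) ?_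
  · rintro ⟨r, ⟨z, hr⟩, hrt⟩
    exact hJ r z p hr (by simpa only [mul_assoc] using hrt)
  · rintro ⟨r, hr⟩ ⟨r', hr'⟩ w hw hw'
    obtain rfl : α w = r := hw
    obtain rfl : α w = r' := hw'
    rfl
  · rintro ⟨⟨r, a⟩, ⟨z, hr⟩, ha, v, hv⟩
    refine .rightCat a (ihL _ ?_) (hJ r z v hr hv)
      (rightCDeterministic_of_exit hC hsurj h hr ha _)
    simpa only [mul_assoc] using ha
  · rintro ⟨⟨r, a⟩, hr, hra, _⟩ ⟨⟨r', a'⟩, hr', hra', _⟩ w ⟨v, hv, u, hu, rfl⟩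
      ⟨v', hv', u', hu', hw⟩
    obtain rfl : α u = r := hu
    obtain rfl : α u' = r' := hu'
    rcases of_mul_of_eq_cases hw with ⟨_, rfl, rfl⟩ | ⟨z, _, rfl⟩ | ⟨z, _, rfl⟩
    · rfl
    · exact (hexit _ _ _ hra' hr).elim
    · exact (hexit _ _ _ hra hr').elim
  · refine Set.eq_empty_iff_forall_notMem.2 ?_
    rintro w ⟨hw, hw'⟩
    simp only [Set.mem_iUnion] at hw hw'
    obtain ⟨⟨r, hr, _⟩, hw⟩ := hw
    obtain ⟨⟨⟨r', a⟩, _, hra, _⟩, v, _, u, hu, rfl⟩ := hw'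
    obtain rfl : α _ = r := hw
    obtain rfl : α u = r' := hu
    exact hexit _ _ _ hra hr

theorem wapol_preimage_context [Finite A] (hC : IsPrevariety C) (hsurj : Function.Surjective α)
    (h : ∀ s t : M, CEquiv C α s t → ∀ e : M, IsIdempotentPower s e → e * s = e * t * e)
    {t : M} (ihJ : ∀ r, (∃ x y, x * r * y = t) → (¬ ∃ x y, x * t * y = r) →
      WAPol C (α ⁻¹' {r})) (p q : M) :
    WAPol C (α ⁻¹' {m | p * m * q = t}) := by
  have wfR := InvImage.wf (fun p : M => {m | ∃ z, p * z = m}) (wellFounded_lt (α := Set M))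
  have wfL := InvImage.wf (fun q : M => {m | ∃ z, z * q = m}) (wellFounded_lt (α := Set M))
  induction p using wfR.induction generalizing q with | _ p ihp => ?_
  induction q using wfL.induction with | _ q ihq => ?_
  by_cases hp : ∃ z, t * z = p
  · by_cases hq : ∃ z, z * t = q
    · obtain ⟨z, hz⟩ := hp
      obtain ⟨z', hz'⟩ := hq
      exact .base (preimage_mem_of_saturated hC.1 _ fun m hm m' hmm' =>
        mul_eq_of_cequiv_of_staying hC.2.1 hsurj h hm hz hz' hmm')
    · refine wapol_of_right_exit hC hsurj h hq ihJ fun x hx => ihq _ (Set.ssubset_iff_exists.2 ?_)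
      refine ⟨?_, q, ⟨1, one_mul q⟩, hx⟩
      rintro _ ⟨z, rfl⟩
      exact ⟨z * x, mul_assoc _ _ _⟩
  · refine wapol_of_left_exit hC hsurj h hp ihJ fun x hx => ihp _ (Set.ssubset_iff_exists.2 ?_) q
    refine ⟨?_, p, ⟨1, mul_one p⟩, hx⟩
    rintro _ ⟨z, rfl⟩
    exact ⟨x * z, (mul_assoc _ _ _).symm⟩

theorem wapol_preimage [Finite A] (hC : IsPrevariety C) (hsurj : Function.Surjective α)
    (h : ∀ s t : M, CEquiv C α s t → ∀ e : M, IsIdempotentPower s e → e * s = e * t * e)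
    (F : Set M) : WAPol C (α ⁻¹' F) := by
  have key : ∀ t : M, WAPol C (α ⁻¹' {t}) := fun t => by
    have wfJ := InvImage.wf (fun t : M => {m | ∃ x y, x * t * y = m})
      (wellFounded_gt (α := Set M))
    induction t using wfJ.induction with | _ t ih => ?_
    have := wapol_preimage_context hC hsurj h (t := t) (fun r hr hrt =>
      ih r (Set.ssubset_iff_exists.2 ⟨?_, r, ⟨1, 1, by simp⟩, hrt⟩)) 1 1
    · simp only [one_mul, mul_one] at this
      exact this
    · obtain ⟨x, y, rfl⟩ := hr
      rintro _ ⟨x', y', rfl⟩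
      exact ⟨x' * x, y * y', by simp only [mul_assoc]⟩
  have hF : α ⁻¹' F = ⋃ r : F, α ⁻¹' {r.1} := by
    ext w
    simp
  rw [hF]
  refine WAPol.iUnion hC.1.1.1 _ (fun r => key r) fun r r' w hr hr' => Subtype.ext ?_
  exact Eq.trans (Eq.symm hr) hr'

end Equation

/-- characterization of `UPol C`-morphisms for a prevariety `C`. -/
theorem upol_morphism_tfae {A : Type} [Fintype A] (C : LangClass A)
    (hC : IsPrevariety C) {M : Type} [Monoid M] [Finite M]
    (α : FreeMonoid A →* M) (hsurj : Function.Surjective α) :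
    [(∀ F : Set M, UPol C (α ⁻¹' F)),
     (∀ F : Set M, APol C (α ⁻¹' F)),
     (∀ F : Set M, WAPol C (α ⁻¹' F)),
     (∀ s t : M, CPair C α s t →
       ∀ e : M, IsIdempotentPower s e → e * s = e * t * e),
     (∀ s t : M, CEquiv C α s t →
       ∀ e : M, IsIdempotentPower s e → e * s = e * t * e)].TFAE := by
  tfae_have 3 → 2 := fun h F => (h F).apol
  tfae_have 2 → 1 := fun h F => (h F).upol
  tfae_have 1 → 4 := fun h _ _ hst _ he => eq_of_cpair_of_pol hC (fun F => (h F).pol) hst he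
  tfae_have 4 → 5 := fun h _ _ hst _ he => eq_of_cequiv_of_forall_cpair hC hsurj h hst he
  tfae_have 5 → 3 := fun h => wapol_preimage hC hsurj h
  tfae_finish

end RegLang
end

section
/- Let C be a positive prevariety of languages over a finite alphabet A and let α : A* → M be a surjective monoid morphism into a finite monoid. Then the canonical coPol(C)-preorder ≼_{coPol(C)} on M is the least preorder ≼ on M such that for all x, y, s ∈ M and every idempotent e ∈ M, if (e,s) is a C-pair for α, then x·e·s·e·y ≼ x·e·y. -/
/- Common definitions: languages over a finite alphabet, classes of languages,
prevarieties, polynomial closure and its variants, separation, C-pairs, etc. -/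

namespace RegLang

variable {A : Type}

section Forest

open scoped Pointwise

variable {M : Type} [Monoid M]

/-- `JLe a b`: the element `a` belongs to the two-sided ideal generated by `b`. -/
def JLe (a b : M) : Prop := ∃ x y : M, a = x * b * y

theorem JLe.refl (a : M) : JLe a a := ⟨1, 1, by simp⟩

theorem JLe.trans {a b c : M} (hab : JLe a b) (hbc : JLe b c) : JLe a c := by
  obtain ⟨x, y, rfl⟩ := hab
  obtain ⟨x', y', rfl⟩ := hbc
  exact ⟨x * x', y' * y, by simp only [mul_assoc]⟩

theorem jle_mul_left (a b : M) : JLe (a * b) b := ⟨a, 1, by simp⟩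

theorem jle_mul_right (a b : M) : JLe (a * b) a := ⟨1, b, by simp⟩

/-- An element stabilizing `p` on the right and `J`-below `p` is a left multiple of `p`. -/
theorem exists_eq_mul_of_mul_eq_self [Finite M] {p m : M} (hpm : p * m = p) (hJ : JLe m p) :
    ∃ c, m = c * p := by
  obtain ⟨a, b, hab⟩ := hJ
  have hstep : m = (a * p) * m * b := by
    rw [mul_assoc a p m, hpm, ← hab]
  have hpow : ∀ k : ℕ, m = (a * p) ^ k * m * b ^ k := by
    intro k
    induction k with
    | zero => simp
    | succ k ih =>
      calc m = (a * p) ^ k * m * b ^ k := ih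
        _ = (a * p) ^ k * ((a * p) * m * b) * b ^ k := by rw [← hstep]
        _ = (a * p) ^ (k + 1) * m * b ^ (k + 1) := by
          rw [pow_succ (a * p), pow_succ' b]; simp only [mul_assoc]
  obtain ⟨k, hk, hidem⟩ : ∃ k : ℕ, 0 < k ∧ IsIdempotentElem (b ^ k) := by
    obtain ⟨i, j, hij, hb⟩ := Finite.exists_ne_map_eq_of_infinite (fun n : ℕ => b ^ n)
    wlog hlt : i < j generalizing i j
    · exact this j i hij.symm hb.symm (by omega)
    obtain ⟨d, hd, rfl⟩ : ∃ d, 0 < d ∧ j = i + d := ⟨j - i, by omega, by omega⟩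
    have hper : ∀ n, b ^ (i + n * d) = b ^ i := by
      intro n
      induction n with
      | zero => simp
      | succ n ih =>
        have hb' : b ^ i = b ^ (i + d) := hb
        rw [add_mul, one_mul, ← add_assoc, pow_add, ih, ← pow_add, ← hb']
    refine ⟨(i + 1) * d, by positivity, ?_⟩
    have hle : i ≤ (i + 1) * d := by nlinarith
    obtain ⟨q, hq⟩ := Nat.exists_eq_add_of_le hle
    have hkk : (i + 1) * d + (i + 1) * d = q + (i + (i + 1) * d) := by omega
    change b ^ ((i + 1) * d) * b ^ ((i + 1) * d) = b ^ ((i + 1) * d)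
    rw [← pow_add, hkk, pow_add, hper, ← pow_add, hq, add_comm]
  have hmb : m * b ^ k = m := by
    conv_lhs => rw [hpow k]
    rw [mul_assoc, hidem.eq, ← hpow k]
  have hm : m = (a * p) ^ k * m := by
    conv_lhs => rw [hpow k, mul_assoc, hmb]
  obtain ⟨k, rfl⟩ : ∃ n, k = n + 1 := ⟨k - 1, by omega⟩
  refine ⟨(a * p) ^ k * a, ?_⟩
  rw [pow_succ, mul_assoc, mul_assoc a p m, hpm] at hm
  rw [mul_assoc]; exact hm

/-- The mirror image of `exists_eq_mul_of_mul_eq_self`. -/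
theorem exists_eq_mul_of_mul_eq_self' [Finite M] {q m : M} (hmq : m * q = q) (hJ : JLe m q) :
    ∃ c, m = q * c := by
  have : Finite Mᵐᵒᵖ := Finite.of_equiv M MulOpposite.opEquiv
  have h := exists_eq_mul_of_mul_eq_self (M := Mᵐᵒᵖ) (p := .op q) (m := .op m)
    (by rw [← MulOpposite.op_mul, hmq]) (by
      obtain ⟨x, y, h⟩ := hJ
      exact ⟨.op y, .op x, by rw [h]; simp only [MulOpposite.op_mul, mul_assoc]⟩)
  obtain ⟨c, hc⟩ := h
  exact ⟨c.unop, by simpa using congrArg MulOpposite.unop hc⟩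

/-- Elements stabilizing a common pair `(p, q)` in a `J`-minimal way are idempotent and equal. -/
theorem eq_and_idempotent_of_stabilizes [Finite M] {p q m m' : M}
    (hp : p * m = p) (hq : m * q = q) (hp' : p * m' = p) (hq' : m' * q = q)
    (hmp : JLe m p) (hmq' : JLe m' q) :
    m = m' ∧ IsIdempotentElem m := by
  obtain ⟨a, ha⟩ := exists_eq_mul_of_mul_eq_self hp hmp
  obtain ⟨c, hc⟩ := exists_eq_mul_of_mul_eq_self' hq' hmq'
  have h1 : m * m' = m := by rw [ha, mul_assoc, hp']
  have h2 : m * m' = m' := by rw [hc, ← mul_assoc, hq]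
  refine ⟨h1.symm.trans h2, ?_⟩
  change m * m = m
  calc m * m = a * (p * m) := by rw [← mul_assoc, ← ha]
    _ = m := by rw [hp, ← ha]

/-- Closure properties of a class of sets of words under which factorization forests of bounded
height show that it contains all words: subsets of unions and products, and iteration inside
the fiber of an idempotent. -/
structure ForestClosed (α : FreeMonoid A →* M) (V : Lang A → Prop) : Prop where
  mono : ∀ {X Y : Lang A}, V Y → X ⊆ Y → V X
  union : ∀ {X Y : Lang A}, V X → V Y → V (X ∪ Y)
  mul : ∀ {X Y : Lang A}, V X → V Y → V (X * Y)
  one : V {1}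
  letter : ∀ a : A, V {FreeMonoid.of a}
  star : ∀ {X : Lang A} (e : M), V X → IsIdempotentElem e → (∀ w ∈ X, α w = e) →
    V (Submonoid.closure X : Set (FreeMonoid A))

theorem ForestClosed.empty {α : FreeMonoid A →* M} {V : Lang A → Prop}
    (h : ForestClosed α V) : V ∅ :=
  h.mono h.one (Set.empty_subset _)

theorem ForestClosed.iUnion {α : FreeMonoid A →* M} {V : Lang A → Prop}
    (h : ForestClosed α V) {ι : Type} [Finite ι] (X : ι → Lang A) (hX : ∀ i, V (X i)) :
    V (⋃ i, X i) := by
  have key : ∀ s : Set ι, s.Finite → V (⋃ i ∈ s, X i) := by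
    intro s hs
    induction s, hs using Set.Finite.induction_on with
    | empty => simpa using h.empty
    | insert _ _ ih => rw [Set.biUnion_insert]; exact h.union (hX _) ih
  simpa using key Set.univ Set.finite_univ

/-- Words labelling a nonempty path of the graph `E` all of whose inner vertices lie in `R`. -/
inductive LabelPath {Q : Type} (E : Q → FreeMonoid A → Q → Prop) (R : Set Q) :
    Q → FreeMonoid A → Q → Prop
  | single {s s' : Q} {y : FreeMonoid A} : E s y s' → LabelPath E R s y s'
  | cons {s r s' : Q} {y w : FreeMonoid A} : E s y r → r ∈ R → LabelPath E R r w s' →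
      LabelPath E R s (y * w) s'

theorem LabelPath.decompose {Q : Type} {E : Q → FreeMonoid A → Q → Prop} {R : Set Q} {r s s' : Q}
    {w : FreeMonoid A} (h : LabelPath E (insert r R) s w s') :
    LabelPath E R s w s' ∨ ∃ u v w', LabelPath E R s u r ∧
      v ∈ Submonoid.closure {v | LabelPath E R r v r} ∧ LabelPath E R r w' s' ∧
      w = u * v * w' := by
  induction h with
  | single h => exact .inl (.single h)
  | @cons s x s' y w hE hx _ ih =>
    rcases hx with rfl | hx
    · right
      rcases ih with ih | ⟨u, v, w', hu, hv, hw, rfl⟩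
      · exact ⟨y, 1, w, .single hE, one_mem _, ih, by simp⟩
      · exact ⟨y, u * v, w', .single hE, mul_mem (Submonoid.subset_closure hu) hv, hw,
          by simp only [mul_assoc]⟩
    · rcases ih with ih | ⟨u, v, w', hu, hv, hw, rfl⟩
      · exact .inl (.cons hE hx ih)
      · exact .inr ⟨y * u, v, w', .cons hE hx hu, hv, hw, by simp only [mul_assoc]⟩

/-- The graph on pairs of a prefix value and a suffix value: an edge moves a word of `Y` from the
suffix to the prefix. -/
def CutStep (α : FreeMonoid A →* M) (Y : Lang A) (s : M × M) (y : FreeMonoid A) (s' : M × M) :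
    Prop :=
  y ∈ Y ∧ s'.1 = s.1 * α y ∧ s.2 = α y * s'.2

theorem LabelPath.cut_values {α : FreeMonoid A →* M} {Y : Lang A} {R : Set (M × M)} {d : M}
    (hY : ∀ y ∈ Y, JLe (α y) d) {s s' : M × M} {w : FreeMonoid A}
    (h : LabelPath (CutStep α Y) R s w s') :
    s'.1 = s.1 * α w ∧ s.2 = α w * s'.2 ∧ JLe (α w) d := by
  induction h with
  | single h => exact ⟨h.2.1, h.2.2, hY _ h.1⟩
  | @cons s r s' y w hE _ _ ih =>
    refine ⟨by rw [ih.1, hE.2.1, map_mul, mul_assoc], by rw [hE.2.2, ih.2.1, map_mul, mul_assoc],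
      ?_⟩
    rw [map_mul]
    exact (jle_mul_left _ _).trans ih.2.2

theorem ForestClosed.labelPath [Finite M] {α : FreeMonoid A →* M} {V : Lang A → Prop}
    (h : ForestClosed α V) {Y : Lang A} (hVY : V Y) {d : M} (hY : ∀ y ∈ Y, JLe (α y) d)
    (R : Set (M × M)) (hR : ∀ r ∈ R, JLe d (r.1 * r.2)) (s s' : M × M) :
    V {w | LabelPath (CutStep α Y) R s w s'} := by
  induction R, R.toFinite using Set.Finite.induction_on generalizing s s' with
  | empty =>
    refine h.mono hVY ?_
    rintro w (hw | ⟨_, hr, _⟩)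
    · exact hw.1
    · exact hr.elim
  | @insert r R _ _ ih =>
    have ih := ih fun x hx => hR x (Set.mem_insert_of_mem _ hx)
    have hr := hR r (Set.mem_insert _ _)
    have hstar : V (Submonoid.closure {v | LabelPath (CutStep α Y) R r v r} :
        Set (FreeMonoid A)) := by
      by_cases hne : ∃ v, LabelPath (CutStep α Y) R r v r
      · obtain ⟨v, hv⟩ := hne
        obtain ⟨hv1, hv2, hvd⟩ := hv.cut_values hY
        have hb : ∀ {x : M}, JLe x d → JLe x r.1 ∧ JLe x r.2 := fun hx =>
          ⟨(hx.trans hr).trans (jle_mul_right _ _), (hx.trans hr).trans (jle_mul_left _ _)⟩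
        refine h.star (α v) (ih r r) ?_ ?_
        · exact (eq_and_idempotent_of_stabilizes hv1.symm hv2.symm hv1.symm hv2.symm
            (hb hvd).1 (hb hvd).2).2
        · intro w hw
          obtain ⟨hw1, hw2, hwd⟩ := LabelPath.cut_values hY hw
          exact (eq_and_idempotent_of_stabilizes hw1.symm hw2.symm hv1.symm hv2.symm
            (hb hwd).1 (hb hvd).2).1
      · refine h.star 1 (ih r r) (one_mul 1) fun w hw => (hne ⟨w, hw⟩).elim
    refine h.mono (h.union (ih s s') (h.mul (h.mul (ih s r) hstar) (ih r s'))) ?_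
    intro w hw
    rcases LabelPath.decompose hw with hw | ⟨u, v, w', hu, hv, hw', rfl⟩
    · exact .inl hw
    · exact .inr (Set.mul_mem_mul (Set.mul_mem_mul hu hv) hw')

theorem labelPath_of_mem_closure {α : FreeMonoid A →* M} {Y : Lang A} {d : M} {w : FreeMonoid A}
    (hw : w ∈ Submonoid.closure Y) (p q : M) (hd : JLe d (p * α w * q)) :
    w = 1 ∨ LabelPath (CutStep α Y) {r | JLe d (r.1 * r.2)} (p, α w * q) w (p * α w, q) := by
  induction hw using Submonoid.closure_induction_left generalizing p with
  | one => exact .inl rfl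
  | mul_left y hy w hw ih =>
    right
    rw [map_mul, ← mul_assoc p] at hd
    rcases ih (p * α y) hd with rfl | hpath
    · rw [mul_one]
      exact .single ⟨hy, rfl, rfl⟩
    · rw [map_mul, ← mul_assoc p]
      exact .cons (r := (p * α y, α w * q)) ⟨hy, rfl, mul_assoc _ _ _⟩
        (show JLe d (p * α y * (α w * q)) by rwa [← mul_assoc]) hpath

/-- Products of words of `J`-class at most that of `d` whose value stays `J`-above `d`. -/
theorem ForestClosed.closure_inter [Finite M] {α : FreeMonoid A →* M} {V : Lang A → Prop}
    (h : ForestClosed α V) {Y : Lang A} (hVY : V Y) {d : M} (hY : ∀ y ∈ Y, JLe (α y) d) :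
    V {w | w ∈ Submonoid.closure Y ∧ JLe d (α w)} := by
  refine h.mono (h.union h.one (h.iUnion (fun t : M => {w | LabelPath (CutStep α Y)
    {r | JLe d (r.1 * r.2)} (1, t) w (t, 1)})
    fun t => h.labelPath hVY hY _ (fun _ hr => hr) _ _)) ?_
  rintro w ⟨hw, hd⟩
  rcases labelPath_of_mem_closure (α := α) (d := d) hw 1 1 (by rwa [one_mul, mul_one]) with hw | hw
  · exact .inl hw
  · exact .inr (Set.mem_iUnion.2 ⟨α w, by simpa using hw⟩)

/-- A form of Simon's factorization forest theorem. -/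
theorem ForestClosed.univ [Finite A] [Finite M] {α : FreeMonoid A →* M} {V : Lang A → Prop}
    (h : ForestClosed α V) : V Set.univ := by
  have wf : WellFounded fun a b : M => JLe b a ∧ ¬ JLe a b :=
    have : IsTrans M fun a b : M => JLe b a ∧ ¬ JLe a b :=
      ⟨fun a b c hab hbc => ⟨hbc.1.trans hab.1, fun hac => hab.2 (hac.trans hbc.1)⟩⟩
    have : Std.Irrefl fun a b : M => JLe b a ∧ ¬ JLe a b := ⟨fun a ha => ha.2 ha.1⟩
    Finite.wellFounded_of_trans_of_irrefl _
  have fiber : ∀ d : M, V {w | JLe d (α w) ∧ JLe (α w) d} := by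
    intro d
    induction d using wf.induction with
    | _ d ih =>
    have hT : V {w | JLe d (α w) ∧ ¬ JLe (α w) d} := by
      refine h.mono (h.iUnion (fun i : {c : M // JLe d c ∧ ¬ JLe c d} =>
        {w | JLe i.1 (α w) ∧ JLe (α w) i.1}) fun i => ih i.1 i.2) ?_
      exact fun w hw => Set.mem_iUnion.2 ⟨⟨α w, hw⟩, JLe.refl _, JLe.refl _⟩
    have hT1 := h.union hT h.one
    have hA : V (⋃ a : A, {FreeMonoid.of a}) := h.iUnion _ h.letter
    set T : Lang A := {w | JLe d (α w) ∧ ¬ JLe (α w) d} ∪ {1} with hTdef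
    have hVY : V (T * (⋃ a : A, {FreeMonoid.of a}) ∩ {w | JLe (α w) d}) :=
      h.mono (h.mul hT1 hA) Set.inter_subset_left
    set Y : Lang A := T * (⋃ a : A, {FreeMonoid.of a}) ∩ {w | JLe (α w) d} with hYdef
    refine h.mono (h.mul (h.closure_inter hVY fun y hy => hy.2) hT1) ?_
    have key : ∀ w : FreeMonoid A, JLe d (α w) →
        w ∈ {w | w ∈ Submonoid.closure Y ∧ JLe d (α w)} * T := by
      intro w
      refine List.reverseRecOn (motive := fun w : FreeMonoid A => JLe d (α w) →
        w ∈ {w | w ∈ Submonoid.closure Y ∧ JLe d (α w)} * T) w ?_ ?_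
      · exact fun hd => Set.mem_mul.2 ⟨1, ⟨one_mem _, hd⟩, 1, .inr rfl, mul_one _⟩
      · intro (w : FreeMonoid A) a ih hd
        change JLe d (α (w * FreeMonoid.of a)) at hd
        change w * FreeMonoid.of a ∈ _
        obtain ⟨v, ⟨hv, hvd⟩, t, ht, rfl⟩ := Set.mem_mul.1
          (ih (hd.trans (by rw [map_mul]; exact jle_mul_right _ _)))
        have hta : JLe d (α (t * FreeMonoid.of a)) := hd.trans (by
          rw [mul_assoc, map_mul]; exact jle_mul_left _ _)
        by_cases hJ : JLe (α (t * FreeMonoid.of a)) d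
        · refine Set.mem_mul.2 ⟨v * (t * FreeMonoid.of a), ⟨mul_mem hv
            (Submonoid.subset_closure ⟨Set.mul_mem_mul ht (Set.mem_iUnion.2 ⟨a, rfl⟩), hJ⟩),
            by rwa [← mul_assoc]⟩, 1, .inr rfl, by rw [mul_one, mul_assoc]⟩
        · exact Set.mem_mul.2 ⟨v, ⟨hv, hvd⟩, t * FreeMonoid.of a, .inl ⟨hta, hJ⟩,
            (mul_assoc _ _ _).symm⟩
    exact fun w hw => key w hw.1
  exact h.mono (h.iUnion _ fiber) fun w _ => Set.mem_iUnion.2 ⟨α w, JLe.refl _, JLe.refl _⟩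

end Forest

section Polynomial

open scoped Pointwise

theorem Pol.biUnion {C : LangClass A} (h0 : ∅ ∈ C) {ι : Type*} {s : Set ι} (hs : s.Finite)
    (X : ι → Lang A) (hX : ∀ i ∈ s, Pol C (X i)) : Pol C (⋃ i ∈ s, X i) := by
  induction s, hs using Set.Finite.induction_on with
  | empty => simpa using Pol.base h0
  | insert _ _ ih =>
    rw [Set.biUnion_insert]
    exact (hX _ (Set.mem_insert _ _)).union (ih fun i hi => hX i (Set.mem_insert_of_mem _ hi))

theorem mul_eq_union_markedCat (K L : Lang A) :
    K * L = {w | 1 ∈ K ∧ w ∈ L} ∪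
      ⋃ a ∈ (Set.univ : Set A), MarkedCat {w | w * FreeMonoid.of a ∈ K} a L := by
  ext w
  simp only [Set.mem_mul, Set.mem_union, Set.mem_iUnion]
  constructor
  · rintro ⟨u, hu, v, hv, rfl⟩
    have hcases : u = 1 ∨ ∃ (u' : FreeMonoid A) (a : A), u = u' * FreeMonoid.of a :=
      List.eq_nil_or_concat' u
    rcases hcases with rfl | ⟨u, a, rfl⟩
    · exact .inl ⟨hu, by simpa using hv⟩
    · exact .inr ⟨a, trivial, u, hu, v, hv, rfl⟩
  · rintro (⟨h1, hw⟩ | ⟨a, -, u, hu, v, hv, rfl⟩)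
    · exact ⟨1, h1, w, hw, one_mul _⟩
    · exact ⟨_, hu, v, hv, rfl⟩

theorem Pol.mul [Finite A] {C : LangClass A} (hC : IsPositivePrevariety C) {K L : Lang A}
    (hK : Pol C K) (hL : Pol C L) : Pol C (K * L) := by
  induction hK with
  | @base K hK =>
    rw [mul_eq_union_markedCat]
    refine .union ?_ (Pol.biUnion hC.1.1 Set.finite_univ _ fun a _ =>
      .mcat a (.base (hC.2.1 K hK _).2) hL)
    by_cases h1 : 1 ∈ K
    · simpa [h1] using hL
    · simpa [h1] using Pol.base hC.1.1
  | union _ _ ih ih' => rw [Set.union_mul]; exact ih.union ih'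
  | @mcat K K' a hK _ _ ih =>
    have : MarkedCat K a K' * L = MarkedCat K a (K' * L) := by
      ext w
      constructor
      · rintro ⟨_, ⟨u, hu, v, hv, rfl⟩, z, hz, rfl⟩
        exact ⟨u, hu, v * z, Set.mul_mem_mul hv hz, mul_assoc _ _ _⟩
      · rintro ⟨u, hu, _, ⟨v, hv, z, hz, rfl⟩, rfl⟩
        exact ⟨_, ⟨u, hu, v, hv, rfl⟩, z, hz, mul_assoc _ _ _⟩
    rw [this]
    exact .mcat a hK ih

theorem IsLatticeClass.sInter_mem {C : LangClass A} (hC : IsLatticeClass C) {S : Set (Lang A)}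
    (hS : S.Finite) (hSC : S ⊆ C) : ⋂₀ S ∈ C := by
  induction S, hS using Set.Finite.induction_on with
  | empty => simpa using hC.2.1
  | insert _ _ ih =>
    rw [Set.sInter_insert]
    exact hC.2.2.2 _ _ (hSC (Set.mem_insert _ _)) (ih ((Set.subset_insert _ _).trans hSC))

/-- Two-sided quotients of a language by words. -/
def quotients (K : Lang A) : Set (Lang A) :=
  {Q | ∃ x y : FreeMonoid A, Q = {w | x * w * y ∈ K}}

theorem IsRegularLang.finite_quotients {K : Lang A} (hK : IsRegularLang K) :
    (quotients K).Finite := by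
  obtain ⟨N, _, _, φ, F, rfl⟩ := hK
  refine (Set.finite_range fun G : Set N => φ ⁻¹' G).subset ?_
  rintro _ ⟨x, y, rfl⟩
  exact ⟨{m | φ x * m * φ y ∈ F}, by ext w; simp⟩

theorem QuotientClosed.quotients_subset {C : LangClass A} (hC : QuotientClosed C) {K : Lang A}
    (hK : K ∈ C) : quotients K ⊆ C := by
  rintro _ ⟨x, y, rfl⟩
  exact (hC _ (hC K hK y).2 x).1

/-- Finitely many languages of a positive prevariety determine finitely many languages `up z`
of the class such that replacing the factor `z` by an element of `up z` preserves membership in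
the given languages. -/
theorem IsPositivePrevariety.exists_up {C : LangClass A} (hC : IsPositivePrevariety C)
    {D : Set (Lang A)} (hD : D.Finite) (hDC : D ⊆ C) :
    ∃ up : FreeMonoid A → Lang A, (Set.range up).Finite ∧ (∀ z, up z ∈ C) ∧ (∀ z, z ∈ up z) ∧
      ∀ z, ∀ v ∈ up z, ∀ K ∈ D, ∀ x y, x * z * y ∈ K → x * v * y ∈ K := by
  have hfin : (⋃ K ∈ D, quotients K).Finite :=
    hD.biUnion fun K hK => (hC.2.2 K (hDC hK)).finite_quotients
  have hsub : (⋃ K ∈ D, quotients K) ⊆ C :=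
    Set.iUnion₂_subset fun K hK => hC.2.1.quotients_subset (hDC hK)
  refine ⟨fun z => ⋂₀ {Q | Q ∈ (⋃ K ∈ D, quotients K) ∧ z ∈ Q}, ?_, ?_, ?_, ?_⟩
  · refine (hfin.finite_subsets.image Set.sInter).subset ?_
    rintro _ ⟨z, rfl⟩
    exact ⟨_, fun Q hQ => hQ.1, rfl⟩
  · exact fun z => hC.1.sInter_mem (hfin.subset fun Q hQ => hQ.1) fun Q hQ => hsub hQ.1
  · exact fun z Q hQ => hQ.2
  · intro z v hv K hK x y hz
    exact hv {w | x * w * y ∈ K} ⟨Set.mem_biUnion hK ⟨x, y, rfl⟩, hz⟩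

theorem mul_eq_mul_of_mul_cases {u w k l : FreeMonoid A} {a : A}
    (h : u * w = k * FreeMonoid.of a * l) :
    (∃ t, u = k * FreeMonoid.of a * t ∧ l = t * w) ∨
      ∃ t, k = u * t ∧ w = t * FreeMonoid.of a * l := by
  rw [mul_assoc] at h
  rcases List.append_eq_append_iff.1 (show List.append u w = List.append k (a :: l) from h) with
    ⟨t, hk, hw⟩ | ⟨t, hu, hl⟩
  · exact .inr ⟨t, hk, hw.trans (mul_assoc (G := FreeMonoid A) t (.of a) l).symm⟩
  · cases t with
    | nil =>
      refine .inr ⟨1, ?_, ?_⟩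
      · rw [mul_one]; exact (hu.trans (List.append_nil _)).symm
      · rw [one_mul]; exact hl.symm
    | cons b t =>
      obtain ⟨rfl, rfl⟩ := List.cons.inj hl
      exact .inl ⟨t, hu.trans (mul_assoc (G := FreeMonoid A) k (.of a) t).symm, rfl⟩

theorem pow_mul_eq_cases {z y k l : FreeMonoid A} {a : A} {n : ℕ}
    (h : z ^ n * y = k * FreeMonoid.of a * l) :
    (∃ p q z₁ z₂, p + q + 1 = n ∧ z = z₁ * FreeMonoid.of a * z₂ ∧ k = z ^ p * z₁ ∧
      l = z₂ * (z ^ q * y)) ∨ ∃ t, k = z ^ n * t ∧ y = t * FreeMonoid.of a * l := by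
  induction n generalizing k with
  | zero => exact .inr ⟨k, by simp, by simpa using h⟩
  | succ n ih =>
    rw [pow_succ', mul_assoc] at h
    rcases mul_eq_mul_of_mul_cases h with ⟨t, hz, hl⟩ | ⟨t, rfl, ht⟩
    · exact .inl ⟨0, n, k, t, by omega, hz, by simp, hl⟩
    · rcases ih ht with ⟨p, q, z₁, z₂, hn, hz, rfl, hl⟩ | ⟨t', rfl, hy⟩
      · exact .inl ⟨p + 1, q, z₁, z₂, by omega, hz, by rw [pow_succ', mul_assoc], hl⟩
      · exact .inr ⟨t', by rw [pow_succ', mul_assoc], hy⟩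

/-- Pumping for polynomial closures: inside a large power of `z`, a word `v` that is above `z` for
finitely many languages of `C` can be inserted. -/
theorem Pol.exists_insertion {C : LangClass A} {L : Lang A} (hL : Pol C L) :
    ∃ D : Set (Lang A), D.Finite ∧ D ⊆ C ∧ ∃ h : ℕ, ∀ z v : FreeMonoid A,
      (∀ K ∈ D, ∀ x y, x * z * y ∈ K → x * v * y ∈ K) → ∀ n, h ≤ n → ∀ x y, x * z ^ n * y ∈ L →
        ∃ i j, x * z ^ (i + 1) * v * z ^ (j + 1) * y ∈ L := by
  induction hL with
  | @base L hL =>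
    refine ⟨{L}, Set.finite_singleton _, Set.singleton_subset_iff.2 hL, 3, ?_⟩
    intro z v hzv n hn x y hxy
    obtain ⟨n, rfl⟩ := Nat.exists_eq_add_of_le hn
    refine ⟨0, n, ?_⟩
    have := hzv L rfl (x * z) (z ^ (n + 1) * y) (by
      convert hxy using 1
      rw [add_comm 3 n, pow_add z n 3, ← pow_mul_comm, pow_succ' z n]
      simp only [pow_succ, pow_zero, one_mul, mul_assoc])
    simpa only [zero_add, pow_one, mul_assoc] using this
  | union _ _ ih ih' =>
    obtain ⟨D, hD, hDC, h, H⟩ := ih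
    obtain ⟨D', hD', hDC', h', H'⟩ := ih'
    refine ⟨D ∪ D', hD.union hD', Set.union_subset hDC hDC', max h h', ?_⟩
    intro z v hzv n hn x y hxy
    rcases hxy with hxy | hxy
    · obtain ⟨i, j, hij⟩ := H z v (fun K hK => hzv K (.inl hK)) n (le_trans (le_max_left _ _) hn)
        x y hxy
      exact ⟨i, j, .inl hij⟩
    · obtain ⟨i, j, hij⟩ := H' z v (fun K hK => hzv K (.inr hK)) n (le_trans (le_max_right _ _) hn)
        x y hxy
      exact ⟨i, j, .inr hij⟩
  | @mcat K L a _ _ ih ih' =>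
    obtain ⟨D, hD, hDC, h, H⟩ := ih
    obtain ⟨D', hD', hDC', h', H'⟩ := ih'
    refine ⟨D ∪ D', hD.union hD', Set.union_subset hDC hDC', h + h' + 1, ?_⟩
    intro z v hzv n hn x y ⟨k, hk, l, hl, hkl⟩
    have H := H z v fun K hK => hzv K (.inl hK)
    have H' := H' z v fun K hK => hzv K (.inr hK)
    rw [mul_assoc] at hkl
    rcases mul_eq_mul_of_mul_cases hkl with ⟨t, rfl, rfl⟩ | ⟨t, rfl, ht⟩
    · obtain ⟨i, j, hij⟩ := H' n (by omega) t y (by rwa [mul_assoc])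
      exact ⟨i, j, k, hk, _, hij, by simp only [mul_assoc]⟩
    · rcases pow_mul_eq_cases ht with ⟨p, q, z₁, z₂, rfl, hz, rfl, rfl⟩ | ⟨t', rfl, rfl⟩
      · by_cases hp : h ≤ p
        · obtain ⟨i, j, hij⟩ := H p hp x z₁ (by rwa [mul_assoc])
          refine ⟨i, j + (q + 1), _, hij, _, hl, ?_⟩
          rw [show j + (q + 1) + 1 = (j + 1) + 1 + q by omega, pow_add z (j + 1 + 1),
            pow_succ z (j + 1)]
          nth_rewrite 3 [hz]
          simp only [mul_assoc]
        · obtain ⟨i, j, hij⟩ := H' q (by omega) z₂ y (by rwa [mul_assoc])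
          refine ⟨p + 1 + i, j, _, hk, _, hij, ?_⟩
          rw [show p + 1 + i + 1 = p + 1 + (i + 1) by omega, pow_add z (p + 1), pow_succ z p]
          nth_rewrite 2 [hz]
          simp only [mul_assoc]
      · obtain ⟨i, j, hij⟩ := H n (by omega) x t' (by rwa [mul_assoc])
        exact ⟨i, j, _, hij, l, hl, by simp only [mul_assoc]⟩

end Polynomial

section CanonicalPreorder

open scoped Pointwise

variable {M : Type} [Monoid M]

theorem CPair.exists_words {C : LangClass A} (hC : IsPositivePrevariety C)
    {α : FreeMonoid A →* M} {s t : M} (h : CPair C α s t) {D : Set (Lang A)} (hD : D.Finite)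
    (hDC : D ⊆ C) : ∃ z v, α z = s ∧ α v = t ∧
      ∀ K ∈ D, ∀ x y, x * z * y ∈ K → x * v * y ∈ K := by
  obtain ⟨up, hfin, hupC, hself, hup⟩ := hC.exists_up hD hDC
  by_contra hcon
  push Not at hcon
  have hunion : ∀ S : Set (Lang A), S.Finite → S ⊆ C → ⋃₀ S ∈ C := by
    intro S hS hSC
    induction S, hS using Set.Finite.induction_on with
    | empty => simpa using hC.1.1
    | insert _ _ ih =>
      rw [Set.sUnion_insert]
      exact hC.1.2.2.1 _ _ (hSC (Set.mem_insert _ _)) (ih ((Set.subset_insert _ _).trans hSC))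
  refine h ⟨⋃₀ (up '' (α ⁻¹' {s})), hunion _ (hfin.subset (Set.image_subset_range _ _)) ?_, ?_, ?_⟩
  · rintro _ ⟨z, _, rfl⟩
    exact hupC z
  · exact fun z hz => ⟨up z, ⟨z, hz, rfl⟩, hself z⟩
  · refine Set.eq_empty_iff_forall_notMem.2 ?_
    rintro v ⟨⟨_, ⟨z, hz, rfl⟩, hv⟩, hvt⟩
    obtain ⟨K, hK, x, y, hxz, hxv⟩ := hcon z v hz hvt
    exact hxv (hup z v hv K hK x y hxz)

theorem CPreorder.coPol_of_cPair {C : LangClass A} (hC : IsPositivePrevariety C)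
    {α : FreeMonoid A →* M} (hsurj : Function.Surjective α) (x y s e : M)
    (he : IsIdempotentElem e) (h : CPair C α e s) :
    CPreorder (coPol C) α (x * e * s * e * y) (x * e * y) := by
  rintro F ⟨L, hL, hFL⟩ hF
  have hmem : ∀ w, α w ∈ F ↔ w ∉ L := fun w => by
    rw [← Set.mem_preimage, hFL, Set.mem_compl_iff]
  obtain ⟨D, hD, hDC, n, H⟩ := hL.exists_insertion
  obtain ⟨z, v, rfl, rfl, hzv⟩ := h.exists_words hC hD hDC
  obtain ⟨x, rfl⟩ := hsurj x
  obtain ⟨y, rfl⟩ := hsurj y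
  have hpow : ∀ k, α (z ^ (k + 1)) = α z := fun k => by rw [map_pow, he.pow_succ_eq]
  by_contra hcon
  have hxy : x * z ^ (n + 1) * y ∈ L := by
    by_contra hxy
    exact hcon (by simpa only [map_mul, hpow] using (hmem _).2 hxy)
  obtain ⟨i, j, hij⟩ := H z v hzv (n + 1) (Nat.le_succ n) x y hxy
  exact (hmem _).1 (by simpa only [map_mul, hpow] using hF) hij

/-- Finitely many languages of `Pol C` cover `X` in such a way that each word of `X` lies in one of
them all of whose words have a value below its own value. -/
def PolCovered (C : LangClass A) (α : FreeMonoid A →* M) (r : M → M → Prop) (X : Lang A) : Prop :=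
  ∃ S : Set (Lang A), S.Finite ∧ (∀ P ∈ S, Pol C P) ∧
    ∀ w ∈ X, ∃ P ∈ S, w ∈ P ∧ ∀ u ∈ P, r (α u) (α w)

theorem closure_cases {X : Lang A} {w : FreeMonoid A} (hw : w ∈ Submonoid.closure X) :
    w = 1 ∨ w ∈ X ∨ ∃ x ∈ X, ∃ v ∈ Submonoid.closure X, ∃ y ∈ X, w = x * v * y := by
  induction hw using Submonoid.closure_induction_left with
  | one => exact .inl rfl
  | mul_left x hx w _ ih =>
    right
    rcases ih with rfl | hw | ⟨x', hx', v, hv, y, hy, rfl⟩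
    · exact .inl (by rwa [mul_one])
    · exact .inr ⟨x, hx, 1, one_mem _, w, hw, by rw [mul_one]⟩
    · exact .inr ⟨x, hx, x' * v, mul_mem (Submonoid.subset_closure hx') hv, y, hy,
        by simp only [mul_assoc]⟩

theorem map_closure_of_fiber {α : FreeMonoid A →* M} {X : Lang A} {e : M}
    (he : IsIdempotentElem e) (hX : ∀ w ∈ X, α w = e) {w : FreeMonoid A}
    (hw : w ∈ Submonoid.closure X) : e * α w = e := by
  induction hw using Submonoid.closure_induction_left with
  | one => simp
  | mul_left x hx w _ ih => rw [map_mul, hX x hx, ← mul_assoc, he.eq, ih]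

theorem forestClosed_polCovered [Finite A] [Finite M] {C : LangClass A}
    (hC : IsPositivePrevariety C) (α : FreeMonoid A →* M) {r : M → M → Prop}
    (hrefl : ∀ a, r a a) (htrans : ∀ a b c, r a b → r b c → r a c)
    (hmul : ∀ a b c d, r a b → r c d → r (a * c) (b * d))
    (hr : ∀ s e : M, IsIdempotentElem e → CPair C α e s → r (e * s * e) e) :
    ForestClosed α (PolCovered C α r) := by
  have hsep : ∀ p : M × M, ∃ K ∈ C, ¬ CPair C α p.1 p.2 →
      Separates K (α ⁻¹' {p.1}) (α ⁻¹' {p.2}) := by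
    intro p
    by_cases hp : CPair C α p.1 p.2
    · exact ⟨∅, hC.1.1, fun h => (h hp).elim⟩
    · obtain ⟨K, hK, hsep⟩ := not_not.1 hp
      exact ⟨K, hK, fun _ => hsep⟩
  choose sep hsepC hsep using hsep
  obtain ⟨up, hfin, hupC, hself, hup⟩ := hC.exists_up (Set.finite_range sep)
    (Set.range_subset_iff.2 hsepC)
  have hpair : ∀ z, ∀ v ∈ up z, ∀ x y, CPair C α (α (x * z * y)) (α (x * v * y)) := by
    intro z v hv x y
    by_contra hcon
    obtain ⟨hs, hs'⟩ := hsep (_, _) hcon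
    exact Set.eq_empty_iff_forall_notMem.1 hs' (x * v * y)
      ⟨hup z v hv _ ⟨_, rfl⟩ x y (hs rfl), rfl⟩
  have hone : ∀ u ∈ up 1, r (α u) 1 := by
    intro u hu
    have := hpair 1 u hu 1 1
    simp only [mul_one, one_mul, map_one] at this
    simpa using hr _ 1 (one_mul 1) this
  refine ⟨?_, ?_, ?_, ?_, ?_, ?_⟩
  · rintro X Y ⟨S, hS, hP, hcov⟩ hXY
    exact ⟨S, hS, hP, fun w hw => hcov w (hXY hw)⟩
  · rintro X Y ⟨S, hS, hP, hcov⟩ ⟨S', hS', hP', hcov'⟩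
    refine ⟨S ∪ S', hS.union hS', fun P h => h.elim (hP P) (hP' P), ?_⟩
    rintro w (hw | hw)
    · obtain ⟨P, h, h'⟩ := hcov w hw
      exact ⟨P, .inl h, h'⟩
    · obtain ⟨P, h, h'⟩ := hcov' w hw
      exact ⟨P, .inr h, h'⟩
  · rintro X Y ⟨S, hS, hP, hcov⟩ ⟨S', hS', hP', hcov'⟩
    refine ⟨Set.image2 (· * ·) S S', hS.image2 _ hS', ?_, ?_⟩
    · rintro _ ⟨P, h, P', h', rfl⟩
      exact (hP P h).mul hC (hP' P' h')
    · rintro _ ⟨x, hx, y, hy, rfl⟩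
      obtain ⟨P, h, hxP, hPr⟩ := hcov x hx
      obtain ⟨P', h', hyP, hPr'⟩ := hcov' y hy
      refine ⟨P * P', ⟨P, h, P', h', rfl⟩, Set.mul_mem_mul hxP hyP, ?_⟩
      rintro _ ⟨u, hu, v, hv, rfl⟩
      simpa only [map_mul] using hmul _ _ _ _ (hPr u hu) (hPr' v hv)
  · refine ⟨{up 1}, Set.finite_singleton _, ?_, ?_⟩
    · rintro _ rfl
      exact .base (hupC 1)
    · rintro _ rfl
      exact ⟨_, rfl, hself 1, fun u hu => by simpa using hone u hu⟩
  · intro a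
    refine ⟨{MarkedCat (up 1) a (up 1)}, Set.finite_singleton _, ?_, ?_⟩
    · rintro _ rfl
      exact .mcat a (.base (hupC 1)) (.base (hupC 1))
    · rintro _ rfl
      refine ⟨_, rfl, ⟨1, hself 1, 1, hself 1, by simp⟩, ?_⟩
      rintro _ ⟨u, hu, v, hv, rfl⟩
      simpa only [map_mul, one_mul, mul_one] using
        hmul _ _ _ _ (hmul _ _ _ _ (hone u hu) (hrefl (α (FreeMonoid.of a)))) (hone v hv)
  · rintro X e ⟨S, hS, hP, hcov⟩ he hX
    refine ⟨{up 1} ∪ S ∪ Set.image2 (· * ·) (Set.image2 (· * ·) S (Set.range up)) S,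
      ((Set.finite_singleton _).union hS).union ((hS.image2 _ hfin).image2 _ hS), ?_, ?_⟩
    · rintro P ((rfl | h) | ⟨_, ⟨P, h, _, ⟨z, rfl⟩, rfl⟩, P', h', rfl⟩)
      · exact .base (hupC 1)
      · exact hP P h
      · exact ((hP P h).mul hC (.base (hupC z))).mul hC (hP P' h')
    · intro w hw
      rcases closure_cases hw with rfl | hw | ⟨x, hx, z, hz, y, hy, rfl⟩
      · exact ⟨up 1, .inl (.inl rfl), hself 1, fun u hu => by simpa using hone u hu⟩
      · obtain ⟨P, h, h'⟩ := hcov w hw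
        exact ⟨P, .inl (.inr h), h'⟩
      · obtain ⟨P, h, hxP, hPr⟩ := hcov x hx
        obtain ⟨P', h', hyP, hPr'⟩ := hcov y hy
        refine ⟨P * up z * P', .inr ⟨_, ⟨P, h, _, ⟨z, rfl⟩, rfl⟩, P', h', rfl⟩,
          Set.mul_mem_mul (Set.mul_mem_mul hxP (hself z)) hyP, ?_⟩
        rintro _ ⟨_, ⟨u, hu, v, hv, rfl⟩, u', hu', rfl⟩
        have hez := map_closure_of_fiber he hX hz
        have hu := hPr u hu
        have hu' := hPr' u' hu'
        have hv := hpair z v hv x 1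
        simp only [map_mul, mul_one, hX x hx, hez] at hv
        simp only [map_mul, hX x hx, hX y hy, hez, he.eq] at hu hu' ⊢
        refine htrans _ _ _ (hmul _ _ _ _ (hmul _ _ _ _ hu (hrefl (α v))) hu') ?_
        simpa only [← mul_assoc, he.eq] using hr _ e he hv

end CanonicalPreorder

/-- the canonical `coPol C`-preorder is the least preorder such that
`x·e·s·e·y ≼ x·e·y` whenever `e` is idempotent and `(e, s)` is a `C`-pair. -/
theorem copol_canonical_preorder_least {A : Type} [Fintype A] (C : LangClass A)
    (hC : IsPositivePrevariety C) {M : Type} [Monoid M] [Finite M]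
    (α : FreeMonoid A →* M) (hsurj : Function.Surjective α) :
    (∀ x y s e : M, IsIdempotentElem e → CPair C α e s →
        CPreorder (coPol C) α (x * e * s * e * y) (x * e * y)) ∧
      (∀ r : M → M → Prop, Reflexive r → Transitive r →
        (∀ x y s e : M, IsIdempotentElem e → CPair C α e s →
          r (x * e * s * e * y) (x * e * y)) →
        ∀ s t : M, CPreorder (coPol C) α s t → r s t) := by
  have := Fintype.finite (α := A) inferInstance
  refine ⟨CPreorder.coPol_of_cPair hC hsurj, fun r hrefl htrans hr s t hst => ?_⟩
  set r' : M → M → Prop := fun a b => ∀ x y, r (x * a * y) (x * b * y)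
  have hrefl' : ∀ a, r' a a := fun a x y => hrefl _
  have htrans' : ∀ a b c, r' a b → r' b c → r' a c := fun a b c hab hbc x y =>
    htrans (hab x y) (hbc x y)
  have hmul' : ∀ a b c d, r' a b → r' c d → r' (a * c) (b * d) := by
    intro a b c d hab hcd x y
    have h1 := hab x (c * y)
    have h2 := hcd (x * b) y
    simp only [mul_assoc] at h1 h2 ⊢
    exact htrans h1 h2
  obtain ⟨S, hS, hP, hcov⟩ := (forestClosed_polCovered hC α hrefl' htrans' hmul'
    fun s e he hes x y => by simpa only [mul_assoc] using hr x y s e he hes).univ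
  have hpol : Pol C (α ⁻¹' {m | ¬ r' s m}) := by
    have : α ⁻¹' {m | ¬ r' s m} = ⋃ P ∈ {P ∈ S | P ⊆ α ⁻¹' {m | ¬ r' s m}}, P := by
      refine Set.Subset.antisymm ?_ (Set.iUnion₂_subset fun P hP => hP.2)
      intro w hw
      obtain ⟨P, hPS, hwP, hPr⟩ := hcov w trivial
      exact Set.mem_biUnion ⟨hPS, fun u hu hsu => hw (htrans' _ _ _ hsu (hPr u hu))⟩ hwP
    rw [this]
    exact Pol.biUnion hC.1.1 (hS.subset fun P h => h.1) _ fun P h => hP P h.1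
  have h := hst {m | r' s m} ⟨_, hpol, by ext w; simp⟩ (hrefl' s) 1 1
  simpa using h

end RegLang
end

section
/- Let C be a positive prevariety of languages over a finite alphabet A. A regular language L belongs to C if and only if its syntactic morphism α_L : A* → M_L is an ordered C-morphism, i.e., α_L⁻¹(F) ∈ C for every subset F ⊆ M_L that is upward closed for the syntactic order ≤_L. -/
/- Common definitions: languages over a finite alphabet, classes of languages,
prevarieties, polynomial closure and its variants, separation, C-pairs, etc. -/

namespace RegLang

variable {A : Type}

theorem IsLatticeClass.biUnion_mem {C : LangClass A} (hC : IsLatticeClass C) {ι : Type*}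
    {S : Set ι} (hS : S.Finite) {f : ι → Lang A} (hf : ∀ i ∈ S, f i ∈ C) :
    (⋃ i ∈ S, f i) ∈ C := by
  induction S, hS using Set.Finite.induction_on with
  | empty => simpa using hC.1
  | insert _ _ ih =>
    rw [Set.biUnion_insert]
    exact hC.2.2.1 _ _ (hf _ (Set.mem_insert _ _))
      (ih fun i hi => hf i (Set.mem_insert_of_mem _ hi))

theorem IsLatticeClass.biInter_mem {C : LangClass A} (hC : IsLatticeClass C) {ι : Type*}
    {S : Set ι} (hS : S.Finite) {f : ι → Lang A} (hf : ∀ i ∈ S, f i ∈ C) :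
    (⋂ i ∈ S, f i) ∈ C := by
  induction S, hS using Set.Finite.induction_on with
  | empty => simpa using hC.2.1
  | insert _ _ ih =>
    rw [Set.biInter_insert]
    exact hC.2.2.2 _ _ (hf _ (Set.mem_insert _ _))
      (ih fun i hi => hf i (Set.mem_insert_of_mem _ hi))

theorem QuotientClosed.setOf_mul_mul_mem {C : LangClass A} (hC : QuotientClosed C) {L : Lang A}
    (hL : L ∈ C) (x y : FreeMonoid A) : {w : FreeMonoid A | x * w * y ∈ L} ∈ C :=
  (hC _ (hC L hL y).2 x).1

theorem IsSyntacticMorphism.mem_iff_of_eq {L : Lang A} {M : Type} [Monoid M]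
    {α : FreeMonoid A →* M} (hα : IsSyntacticMorphism L α) {u v : FreeMonoid A}
    (h : α u = α v) : u ∈ L ↔ v ∈ L := by
  simpa using (hα.2 u v).1 h 1 1

/-- The upward closure of a word for the syntactic preorder is an intersection of finitely many
quotients of the language, one for each pair of elements of the syntactic monoid. -/
theorem setOf_synPre_mem {C : LangClass A} (hlat : IsLatticeClass C) (hquot : QuotientClosed C)
    {L : Lang A} (hL : L ∈ C) {M : Type} [Monoid M] [Finite M] {α : FreeMonoid A →* M}
    (hα : IsSyntacticMorphism L α) (u : FreeMonoid A) : {v | SynPre L u v} ∈ C := by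
  obtain ⟨g, hg⟩ := hα.1.hasRightInverse
  have key : {v | SynPre L u v} =
      ⋂ p ∈ {p : M × M | g p.1 * u * g p.2 ∈ L}, {v | g p.1 * v * g p.2 ∈ L} := by
    ext v
    simp only [Set.mem_ofPred_eq, Set.mem_iInter]
    refine ⟨fun h p hp => h _ _ hp, fun h x y hxy => ?_⟩
    have hrep : ∀ w, g (α x) * w * g (α y) ∈ L ↔ x * w * y ∈ L := fun w =>
      hα.mem_iff_of_eq (by simp [hg _])
    exact (hrep v).1 (h (α x, α y) ((hrep u).2 hxy))
  rw [key]
  exact hlat.biInter_mem (Set.toFinite _) fun p _ => hquot.setOf_mul_mul_mem hL _ _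

/-- a regular language belongs to a positive prevariety `C` iff its
syntactic morphism is an ordered `C`-morphism (preimages of sets upward closed for the
syntactic order lie in `C`). -/
theorem mem_iff_syntactic_ordered_cmorphism {A : Type} [Fintype A] (C : LangClass A)
    (hC : IsPositivePrevariety C) (L : Lang A) (hL : IsRegularLang L)
    {M : Type} [Monoid M] [Finite M] (α : FreeMonoid A →* M) (le : M → M → Prop)
    (hα : IsSyntacticMorphism L α) (hle : IsSyntacticOrder L α le) :
    L ∈ C ↔ ∀ F : Set M, UpClosed le F → α ⁻¹' F ∈ C := by
  refine ⟨fun hLC F hF => ?_, fun h => ?_⟩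
  · obtain ⟨g, hg⟩ := hα.1.hasRightInverse
    have key : α ⁻¹' F = ⋃ s ∈ F, {v | SynPre L (g s) v} := by
      ext v
      simp only [Set.mem_preimage, Set.mem_iUnion, Set.mem_ofPred_eq, exists_prop]
      constructor
      · exact fun hv => ⟨α v, hv, (hle _ _).1 (by rw [hg]; exact (hle v v).2 fun _ _ => id)⟩
      · rintro ⟨s, hs, hsv⟩
        have hsle := (hle _ _).2 hsv
        rw [hg] at hsle
        exact hF s hs _ hsle
    rw [key]
    exact hC.1.biUnion_mem (Set.toFinite _) fun s _ => setOf_synPre_mem hC.1 hC.2.1 hLC hα _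
  · have key : α ⁻¹' (α '' L) = L := by
      refine Set.Subset.antisymm ?_ (Set.subset_preimage_image _ _)
      rintro w ⟨u, hu, huw⟩
      exact (hα.mem_iff_of_eq huw).1 hu
    rw [← key]
    refine h _ ?_
    rintro _ ⟨u, hu, rfl⟩ t ht
    obtain ⟨v, rfl⟩ := hα.1 t
    exact ⟨v, by simpa using (hle u v).1 ht 1 1 (by simpa using hu), rfl⟩

end RegLang
end
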